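/- Fix 0 < R₁ < R₂. There exists δ₀ ∈ (0, π/2) such that for all δ ∈ (0, δ₀): λ₂(B_{R₂} \ K_δ) < λ₁(B_{R₂}⁺ \ K_δ⁺). (Equivalently, with ε = π/2 − δ, there exists ε₀ ∈ (0, π/2) such that for ε ∈ [ε₀, π/2) the lowest eigenvalue λ₁^{NDD} of the cracked quarter-disk with Neumann on θ = 0 and Dirichlet on θ = π/2 is strictly smaller than the lowest eigenvalue λ₁^{DND} with Dirichlet on θ = 0 and Neumann on θ = π/2.) -/

import Mathlib

open MeasureTheory Real Set

noncomputable section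

/-- A Dirichlet test function on `ω`: smooth, compactly supported, with support in `ω`. -/
def testFun (ω : Set (ℝ × ℝ)) (u : (ℝ × ℝ) → ℝ) : Prop :=
  ContDiff ℝ (⊤ : ℕ∞) u ∧ HasCompactSupport u ∧ tsupport u ⊆ ω

/-- `|∇u|²` at a point. -/
def gradSq (u : (ℝ × ℝ) → ℝ) (x : ℝ × ℝ) : ℝ :=
  fderiv ℝ u x (1, 0) ^ 2 + fderiv ℝ u x (0, 1) ^ 2

/-- The Rayleigh quotient of `u` on `ω`. -/
def rayleigh (ω : Set (ℝ × ℝ)) (u : (ℝ × ℝ) → ℝ) : ℝ :=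
  (∫ x in ω, gradSq u x) / ∫ x in ω, u x ^ 2

/-- The `k`-th Dirichlet eigenvalue of `ω` (`k ≥ 1`), via the Courant–Fischer
min-max formula over `k`-dimensional subspaces of `C_c^∞(ω)`. -/
def dirichletEV (ω : Set (ℝ × ℝ)) (k : ℕ) : ℝ :=
  sInf {l | ∃ V : Submodule ℝ ((ℝ × ℝ) → ℝ),
    (V : Set ((ℝ × ℝ) → ℝ)) ⊆ {u | testFun ω u} ∧ Module.finrank ℝ V = k ∧
    l = sSup {r | ∃ u ∈ V, u ≠ 0 ∧ r = rayleigh ω u}}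

/-- The open disk `B_R` centered at the origin. -/
def disk (R : ℝ) : Set (ℝ × ℝ) := {x | x.1 ^ 2 + x.2 ^ 2 < R ^ 2}

/-- The open annulus `M_{R₁,R₂} = B_{R₂} \ closure (B_{R₁})`. -/
def annulus (R₁ R₂ : ℝ) : Set (ℝ × ℝ) := disk R₂ \ closure (disk R₁)

/-- `D_{R₁,R₂} = B_{R₁} ∪ M_{R₁,R₂}`. -/
def diskUnionAnnulus (R₁ R₂ : ℝ) : Set (ℝ × ℝ) := disk R₁ ∪ annulus R₁ R₂

/-- The cracked domain `𝔇(N,ε)`. -/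
def crackedDomain (R₁ R₂ : ℝ) (N : ℕ) (ε : ℝ) : Set (ℝ × ℝ) :=
  diskUnionAnnulus R₁ R₂ ∪
    ⋃ j ∈ Finset.range N, {x | ∃ θ : ℝ, θ ∈ Set.Ioo (2 * π * j / N - ε) (2 * π * j / N + ε) ∧
      x = (R₁ * Real.cos θ, R₁ * Real.sin θ)}

/-- The open upper half-disk `B_R⁺ = B_R ∩ {x₂ > 0}`. -/
def halfDisk (R : ℝ) : Set (ℝ × ℝ) := disk R ∩ {x | 0 < x.2}

/-- The compact set `K_δ`: two closed arcs of angular half-width `δ` on the circle of radius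
`R₁`, centered at the points `(0, R₁)` and `(0, −R₁)`. -/
def crackSet (R₁ δ : ℝ) : Set (ℝ × ℝ) :=
  {x | ∃ θ : ℝ, (θ ∈ Set.Icc (π / 2 - δ) (π / 2 + δ) ∨
      θ ∈ Set.Icc (-(π / 2) - δ) (-(π / 2) + δ)) ∧
    x = (R₁ * Real.cos θ, R₁ * Real.sin θ)}

/-- `K_δ⁺ = K_δ ∩ {x₂ > 0}`. -/
def crackSetPlus (R₁ δ : ℝ) : Set (ℝ × ℝ) := crackSet R₁ δ ∩ {x | 0 < x.2}

theorem summable_mul_pow_of_factorial_bound {a : ℕ → ℝ} (ha : ∀ k, |a k| ≤ 1 / (k.factorial : ℝ))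
    (t : ℝ) : Summable fun k => a k * t ^ k := by
  refine Summable.of_norm_bounded (Real.summable_pow_div_factorial |t|) fun k => ?_
  rw [norm_mul, norm_pow, Real.norm_eq_abs, Real.norm_eq_abs]
  calc |a k| * |t| ^ k ≤ 1 / (k.factorial : ℝ) * |t| ^ k := by gcongr; exact ha k
    _ = |t| ^ k / k.factorial := by ring

theorem factorial_bound_succ {a : ℕ → ℝ} (ha : ∀ k, |a k| ≤ 1 / (k.factorial : ℝ)) (k : ℕ) :
    |((k : ℝ) + 1) * a (k + 1)| ≤ 1 / (k.factorial : ℝ) := by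
  rw [abs_mul, abs_of_nonneg (by positivity : (0 : ℝ) ≤ (k : ℝ) + 1)]
  calc ((k : ℝ) + 1) * |a (k + 1)| ≤ ((k : ℝ) + 1) * (1 / ((k + 1).factorial : ℝ)) := by
        gcongr; exact ha _
    _ = 1 / (k.factorial : ℝ) := by
        rw [Nat.factorial_succ]; push_cast
        have := Nat.factorial_ne_zero k
        field_simp

theorem hasDerivAt_tsum_mul_pow {a : ℕ → ℝ} (ha : ∀ k, |a k| ≤ 1 / (k.factorial : ℝ)) (t : ℝ) :
    HasDerivAt (fun t : ℝ => ∑' k, a k * t ^ k) (∑' k : ℕ, ((k : ℝ) + 1) * a (k + 1) * t ^ k) t := by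
  set r : ℝ := |t| + 1
  have hr : 0 < r := by positivity
  have hu : Summable fun k : ℕ => |a k| * (k * r ^ (k - 1)) := by
    rw [← summable_nat_add_iff 1]
    refine Summable.of_norm_bounded (Real.summable_pow_div_factorial r) fun k => ?_
    have h := factorial_bound_succ ha k
    rw [abs_mul, abs_of_nonneg (by positivity : (0 : ℝ) ≤ (k : ℝ) + 1)] at h
    rw [Real.norm_of_nonneg (by positivity)]
    push_cast
    calc |a (k + 1)| * (((k : ℝ) + 1) * r ^ k) = ((k : ℝ) + 1) * |a (k + 1)| * r ^ k := by ring
      _ ≤ 1 / (k.factorial : ℝ) * r ^ k := by gcongr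
      _ = r ^ k / k.factorial := by ring
  have hmem : t ∈ Metric.ball (0 : ℝ) r := by simp [r]
  have key := hasDerivAt_tsum_of_isPreconnected (g := fun k (t : ℝ) => a k * t ^ k)
    (g' := fun k (t : ℝ) => a k * (k * t ^ (k - 1))) hu Metric.isOpen_ball
    (convex_ball (0 : ℝ) r).isPreconnected
    (fun k y _ => (hasDerivAt_pow k y).const_mul (a k))
    (fun k y hy => by
      have hy' : |y| ≤ r := by simpa using (Metric.mem_ball.1 hy).le
      rw [norm_mul, norm_mul, norm_pow, Real.norm_eq_abs, Real.norm_eq_abs, Real.norm_eq_abs,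
        Nat.abs_cast]
      gcongr)
    hmem (summable_mul_pow_of_factorial_bound ha t) hmem
  refine key.congr_deriv ?_
  have hs : Summable fun k : ℕ => a k * (k * t ^ (k - 1)) := by
    refine Summable.of_norm_bounded hu fun k => ?_
    rw [norm_mul, norm_mul, norm_pow, Real.norm_eq_abs, Real.norm_eq_abs, Real.norm_eq_abs,
      Nat.abs_cast]
    have : |t| ≤ r := by simp [r]
    gcongr
  rw [hs.tsum_eq_zero_add]
  simp only [Nat.cast_zero, zero_mul, mul_zero, zero_add]
  refine tsum_congr fun k => ?_
  push_cast
  ring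

theorem contDiff_tsum_mul_pow (n : ℕ) : ∀ {a : ℕ → ℝ}, (∀ k, |a k| ≤ 1 / (k.factorial : ℝ)) →
    ContDiff ℝ n fun t : ℝ => ∑' k, a k * t ^ k := by
  induction n with
  | zero =>
    intro a ha
    exact contDiff_zero.2
      (continuous_iff_continuousAt.2 fun t => (hasDerivAt_tsum_mul_pow ha t).continuousAt)
  | succ n ih =>
    intro a ha
    push_cast
    refine contDiff_succ_iff_deriv.2
      ⟨fun t => (hasDerivAt_tsum_mul_pow ha t).differentiableAt, by simp, ?_⟩
    rw [funext fun t => (hasDerivAt_tsum_mul_pow ha t).deriv]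
    exact ih (factorial_bound_succ ha)

/-- The Taylor coefficients of `t ↦ J₁(2√t)/√t`. -/
def besselCoeff (k : ℕ) : ℝ := (-1) ^ k / (k.factorial * (k + 1).factorial)

/-- The entire function `t ↦ J₁(2√t)/√t`. -/
def besselFun (t : ℝ) : ℝ := ∑' k, besselCoeff k * t ^ k

theorem abs_besselCoeff (k : ℕ) :
    |besselCoeff k| = 1 / ((k.factorial : ℝ) * (k + 1).factorial) := by
  rw [besselCoeff, abs_div, abs_pow, abs_neg, abs_one, one_pow, abs_of_nonneg (by positivity)]

theorem besselCoeff_bound (k : ℕ) : |besselCoeff k| ≤ 1 / (k.factorial : ℝ) := by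
  rw [abs_besselCoeff]
  have h1 : (1 : ℝ) ≤ (k + 1).factorial := by exact_mod_cast Nat.succ_le_of_lt (Nat.factorial_pos _)
  have h2 : (0 : ℝ) < k.factorial := by exact_mod_cast Nat.factorial_pos k
  gcongr
  nlinarith

theorem besselCoeff_succ (k : ℕ) :
    ((k : ℝ) + 1) * (k + 2) * besselCoeff (k + 1) = -besselCoeff k := by
  simp only [besselCoeff, Nat.factorial_succ, pow_succ]
  push_cast
  have := Nat.factorial_ne_zero k
  field_simp
  ring

theorem contDiff_besselFun : ContDiff ℝ (⊤ : ℕ∞) besselFun :=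
  contDiff_infty.2 fun n => contDiff_tsum_mul_pow n besselCoeff_bound

theorem besselFun_zero : besselFun 0 = 1 := by
  rw [besselFun, tsum_eq_single 0 (by intro k hk; simp [hk])]
  simp [besselCoeff]

theorem besselFun_ode (t : ℝ) :
    t * deriv (deriv besselFun) t + 2 * deriv besselFun t = -besselFun t := by
  have h1 : deriv besselFun = fun t => ∑' k : ℕ, ((k : ℝ) + 1) * besselCoeff (k + 1) * t ^ k :=
    funext fun t => (hasDerivAt_tsum_mul_pow besselCoeff_bound t).deriv
  have hb := factorial_bound_succ besselCoeff_bound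
  have h2 : deriv (deriv besselFun) t = ∑' k : ℕ, ((k : ℝ) + 1) *
      (((k + 1 : ℕ) + 1 : ℝ) * besselCoeff (k + 1 + 1)) * t ^ k := by
    rw [h1]; exact (hasDerivAt_tsum_mul_pow hb t).deriv
  have s1 := summable_mul_pow_of_factorial_bound hb t
  have s2 := summable_mul_pow_of_factorial_bound (factorial_bound_succ hb) t
  have s3 : Summable fun k : ℕ => (k : ℝ) * (((k : ℝ) + 1) * besselCoeff (k + 1)) * t ^ k := by
    rw [← summable_nat_add_iff 1]
    refine (s2.mul_left t).congr fun k => ?_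
    push_cast; ring
  have e3 : t * deriv (deriv besselFun) t =
      ∑' k : ℕ, (k : ℝ) * (((k : ℝ) + 1) * besselCoeff (k + 1)) * t ^ k := by
    rw [h2, s3.tsum_eq_zero_add, ← tsum_mul_left]
    simp only [Nat.cast_zero, zero_mul, zero_add]
    refine tsum_congr fun k => ?_
    push_cast; ring
  rw [e3, h1, ← tsum_mul_left, ← s3.tsum_add (s1.mul_left 2), besselFun, ← tsum_neg]
  refine tsum_congr fun k => ?_
  have := besselCoeff_succ k
  linear_combination t ^ k * this

theorem besselFun_four_neg : besselFun 4 < 0 := by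
  have hs := summable_mul_pow_of_factorial_bound besselCoeff_bound 4
  have hbound : ∀ k : ℕ, |besselCoeff (k + 6) * 4 ^ (k + 6)| ≤ 1 / 500 * (1 / 2) ^ k := by
    intro k
    induction k with
    | zero => rw [abs_mul, abs_besselCoeff]; norm_num [Nat.factorial]
    | succ k ih =>
      have h := besselCoeff_succ (k + 6)
      have h' : |besselCoeff (k + 1 + 6)| ≤ |besselCoeff (k + 6)| * (1 / 8) := by
        rw [← abs_neg (besselCoeff (k + 6)), ← h, abs_mul,
          abs_of_nonneg (by positivity : (0 : ℝ) ≤ ((k + 6 : ℕ) + 1) * ((k + 6 : ℕ) + 2)),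
          show k + 1 + 6 = k + 6 + 1 by ring]
        push_cast
        nlinarith [abs_nonneg (besselCoeff (k + 6 + 1)), mul_nonneg
          (by positivity : (0 : ℝ) ≤ (k : ℝ) ^ 2 + 15 * k + 48) (abs_nonneg (besselCoeff (k + 6 + 1)))]
      rw [abs_mul] at ih ⊢
      rw [abs_of_nonneg (by positivity : (0 : ℝ) ≤ 4 ^ (k + 6))] at ih
      rw [abs_of_nonneg (by positivity : (0 : ℝ) ≤ 4 ^ (k + 1 + 6))]
      calc |besselCoeff (k + 1 + 6)| * 4 ^ (k + 1 + 6)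
          ≤ |besselCoeff (k + 6)| * (1 / 8) * 4 ^ (k + 1 + 6) := by gcongr
        _ = |besselCoeff (k + 6)| * 4 ^ (k + 6) * (1 / 2) := by ring
        _ ≤ 1 / 500 * (1 / 2) ^ k * (1 / 2) := by gcongr
        _ = 1 / 500 * (1 / 2) ^ (k + 1) := by ring
  have htail : |∑' k : ℕ, besselCoeff (k + 6) * 4 ^ (k + 6)| ≤ 1 / 250 := by
    have := tsum_of_norm_bounded (f := fun k : ℕ => besselCoeff (k + 6) * 4 ^ (k + 6)) (hasSum_geometric_two.mul_left (1 / 500 : ℝ)) hbound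
    rw [Real.norm_eq_abs] at this
    linarith
  rw [besselFun, ← hs.sum_add_tsum_nat_add 6]
  have := (abs_le.1 htail).2
  have hsum : ∑ k ∈ Finset.range 6, besselCoeff k * 4 ^ k < - 1 / 50 := by
    simp only [Finset.sum_range_succ, Finset.sum_range_zero, besselCoeff, Nat.factorial]
    norm_num
  linarith

theorem exists_besselFun_first_zero :
    ∃ t₀ > 0, besselFun t₀ = 0 ∧ ∀ t ∈ Ico 0 t₀, 0 < besselFun t := by
  have hc : Continuous besselFun := contDiff_besselFun.continuous
  let S := Icc (0 : ℝ) 4 ∩ besselFun ⁻¹' {0}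
  have hS : IsCompact S := isCompact_Icc.inter_right (isClosed_singleton.preimage hc)
  have hne : S.Nonempty := by
    obtain ⟨t, ht, h⟩ := intermediate_value_Icc' (by norm_num : (0 : ℝ) ≤ 4) hc.continuousOn
      (show (0 : ℝ) ∈ Icc (besselFun 4) (besselFun 0) from
        ⟨besselFun_four_neg.le, by rw [besselFun_zero]; norm_num⟩)
    exact ⟨t, ht, h⟩
  obtain ⟨t₀, ⟨⟨h0, h4⟩, hz⟩, hmin⟩ := hS.exists_isLeast hne
  refine ⟨t₀, h0.lt_of_ne ?_, hz, fun t ht => ?_⟩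
  · rintro rfl
    simp [besselFun_zero] at hz
  · by_contra! h
    obtain ⟨s, hs, hs0⟩ := intermediate_value_Icc' ht.1 hc.continuousOn
      (show (0 : ℝ) ∈ Icc (besselFun t) (besselFun 0) from
        ⟨h, by rw [besselFun_zero]; norm_num⟩)
    exact absurd (hmin ⟨⟨hs.1, by linarith [hs.2, ht.2]⟩, hs0⟩) (by linarith [hs.2, ht.2])

/-- The radial factor `g` of the first Dirichlet eigenfunction `x ↦ x₂ g(|x|²)` of a half-disk. -/
structure IsRadialFactor (R κ : ℝ) (g : ℝ → ℝ) : Prop where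
  contDiff : ContDiff ℝ (⊤ : ℕ∞) g
  ode : ∀ s, s * deriv (deriv g) s + 2 * deriv g s = -κ * g s
  zero : g (R ^ 2) = 0
  pos : ∀ s ∈ Ico 0 (R ^ 2), 0 < g s
  anti : AntitoneOn g (Icc 0 (R ^ 2))

theorem exists_isRadialFactor {R : ℝ} (hR : 0 < R) : ∃ κ g, IsRadialFactor R κ g := by
  obtain ⟨t₀, ht₀, hz, hpos⟩ := exists_besselFun_first_zero
  set κ := t₀ / R ^ 2 with hκ
  have hκ0 : 0 < κ := by positivity
  have hκR : κ * R ^ 2 = t₀ := by rw [hκ]; field_simp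
  have hd : Differentiable ℝ besselFun := contDiff_besselFun.differentiable (by simp)
  have hd1 : ContDiff ℝ (⊤ : ℕ∞) (deriv besselFun) :=
    (contDiff_infty_iff_deriv.1 contDiff_besselFun).2
  have hd' : Differentiable ℝ (deriv besselFun) := hd1.differentiable (by simp)
  have hlin : ∀ s, HasDerivAt (fun s => κ * s) κ s := fun s => by
    simpa using (hasDerivAt_id s).const_mul κ
  have e1 : deriv (fun s => besselFun (κ * s)) = fun s => deriv besselFun (κ * s) * κ :=
    funext fun s => ((hd _).hasDerivAt.comp s (hlin s)).deriv
  have e2 : ∀ s, deriv (deriv (fun s => besselFun (κ * s))) s =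
      deriv (deriv besselFun) (κ * s) * κ * κ := fun s => by
    rw [e1]; exact (((hd' _).hasDerivAt.comp s (hlin s)).mul_const κ).deriv
  have hg : ContDiff ℝ (⊤ : ℕ∞) fun s => besselFun (κ * s) :=
    contDiff_besselFun.comp (contDiff_const.mul contDiff_id)
  have hp : ∀ s ∈ Ico 0 (R ^ 2), 0 < besselFun (κ * s) := fun s hs =>
    hpos _ ⟨mul_nonneg hκ0.le hs.1, by rw [← hκR]; exact mul_lt_mul_of_pos_left hs.2 hκ0⟩
  refine ⟨κ, fun s => besselFun (κ * s), hg, fun s => ?_, by simp [hκR, hz], hp, ?_⟩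
  · rw [e2, e1]
    linear_combination κ * besselFun_ode (κ * s)
  · have hneg : ∀ t ∈ Ioo 0 t₀, deriv besselFun t ≤ 0 := by
      intro t ht
      have hder : ∀ t, HasDerivAt (fun t => t ^ 2 * deriv besselFun t) (-(t * besselFun t)) t := by
        intro t
        have := (hasDerivAt_pow 2 t).mul (hd' t).hasDerivAt
        refine this.congr_deriv ?_
        have := besselFun_ode t
        push_cast
        linear_combination t * this
      have hanti : AntitoneOn (fun t => t ^ 2 * deriv besselFun t) (Icc 0 t₀) := by
        refine antitoneOn_of_deriv_nonpos (convex_Icc _ _)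
          (fun t _ => (hder t).continuousAt.continuousWithinAt)
          (fun t _ => (hder t).differentiableAt.differentiableWithinAt) fun t ht => ?_
        rw [interior_Icc] at ht
        rw [(hder t).deriv]
        have := hpos t ⟨ht.1.le, ht.2⟩
        nlinarith [ht.1]
      have := hanti ⟨le_rfl, ht₀.le⟩ ⟨ht.1.le, ht.2.le⟩ ht.1.le
      simp only [ne_eq, OfNat.ofNat_ne_zero, not_false_eq_true, zero_pow, zero_mul] at this
      by_contra! h
      nlinarith [mul_pos (pow_pos ht.1 2) h]
    refine antitoneOn_of_deriv_nonpos (convex_Icc _ _) hg.continuous.continuousOn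
      (hg.differentiable (by simp)).differentiableOn fun s hs => ?_
    rw [interior_Icc] at hs
    rw [e1]
    have := hneg (κ * s) ⟨mul_pos hκ0 hs.1, by
      rw [← hκR]; exact mul_lt_mul_of_pos_left hs.2 hκ0⟩
    nlinarith

theorem fderiv_fst_eq {f : ℝ × ℝ → ℝ} {x : ℝ × ℝ} {d : ℝ} (hf : DifferentiableAt ℝ f x)
    (h : HasDerivAt (fun t => f (t, x.2)) d x.1) : fderiv ℝ f x (1, 0) = d := by
  have hl : HasDerivAt (fun t : ℝ => ((t, x.2) : ℝ × ℝ)) (1, 0) x.1 :=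
    (hasDerivAt_id _).prodMk (hasDerivAt_const _ _)
  exact (HasFDerivAt.comp_hasDerivAt x.1 (f := fun t : ℝ => ((t, x.2) : ℝ × ℝ))
    (l := f) hf.hasFDerivAt hl).unique h

theorem fderiv_snd_eq {f : ℝ × ℝ → ℝ} {x : ℝ × ℝ} {d : ℝ} (hf : DifferentiableAt ℝ f x)
    (h : HasDerivAt (fun t => f (x.1, t)) d x.2) : fderiv ℝ f x (0, 1) = d := by
  have hl : HasDerivAt (fun t : ℝ => ((x.1, t) : ℝ × ℝ)) (0, 1) x.2 :=
    (hasDerivAt_const _ _).prodMk (hasDerivAt_id _)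
  exact (HasFDerivAt.comp_hasDerivAt x.2 (f := fun t : ℝ => ((x.1, t) : ℝ × ℝ))
    (l := f) hf.hasFDerivAt hl).unique h

theorem contDiff_fderiv_apply {f : ℝ × ℝ → ℝ} (hf : ContDiff ℝ (⊤ : ℕ∞) f) (v : ℝ × ℝ) :
    ContDiff ℝ (⊤ : ℕ∞) fun x => fderiv ℝ f x v :=
  (hf.fderiv_right (by simp)).clm_apply contDiff_const

theorem gradSq_nonneg (u : ℝ × ℝ → ℝ) (x : ℝ × ℝ) : 0 ≤ gradSq u x := by
  unfold gradSq; positivity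

theorem continuous_gradSq {u : ℝ × ℝ → ℝ} (hu : ContDiff ℝ (⊤ : ℕ∞) u) :
    Continuous (gradSq u) :=
  ((contDiff_fderiv_apply hu _).continuous.pow 2).add
    ((contDiff_fderiv_apply hu _).continuous.pow 2)

theorem fderiv_eq_zero_of_notMem_tsupport {u : ℝ × ℝ → ℝ} {x : ℝ × ℝ} (hx : x ∉ tsupport u) :
    fderiv ℝ u x = 0 :=
  image_eq_zero_of_notMem_tsupport fun h => hx (tsupport_fderiv_subset ℝ h)

theorem gradSq_eq_zero_of_notMem_tsupport {u : ℝ × ℝ → ℝ} {x : ℝ × ℝ} (hx : x ∉ tsupport u) :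
    gradSq u x = 0 := by
  simp [gradSq, fderiv_eq_zero_of_notMem_tsupport hx]

theorem HasCompactSupport.gradSq {u : ℝ × ℝ → ℝ} (hu : HasCompactSupport u) :
    HasCompactSupport (gradSq u) :=
  hu.mono' fun _ hx => by_contra fun h => hx (gradSq_eq_zero_of_notMem_tsupport h)

theorem HasCompactSupport.sq {u : ℝ × ℝ → ℝ} (hu : HasCompactSupport u) :
    HasCompactSupport fun x => u x ^ 2 :=
  hu.comp_left (g := fun t => t ^ 2) (by simp)

theorem integrable_sq {u : ℝ × ℝ → ℝ} (hu : Continuous u) (hc : HasCompactSupport u) :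
    Integrable fun x => u x ^ 2 :=
  (hu.pow 2).integrable_of_hasCompactSupport hc.sq

theorem integrable_gradSq {u : ℝ × ℝ → ℝ} (hu : ContDiff ℝ (⊤ : ℕ∞) u)
    (hc : HasCompactSupport u) : Integrable (gradSq u) :=
  (continuous_gradSq hu).integrable_of_hasCompactSupport hc.gradSq

theorem integral_sq_pos {u : ℝ × ℝ → ℝ} (hu : Continuous u) (hc : HasCompactSupport u)
    (h0 : u ≠ 0) : 0 < ∫ x, u x ^ 2 := by
  obtain ⟨x, hx⟩ := Function.ne_iff.1 h0
  exact (hu.pow 2).integral_pos_of_hasCompactSupport_nonneg_nonzero hc.sq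
    (fun x => sq_nonneg _) (pow_ne_zero 2 hx)

theorem integral_gradSq_mul {φ w : ℝ × ℝ → ℝ} {l : ℝ} (hφ : ContDiff ℝ (⊤ : ℕ∞) φ)
    (hlap : ∀ x, fderiv ℝ (fun y => fderiv ℝ φ y (1, 0)) x (1, 0) +
      fderiv ℝ (fun y => fderiv ℝ φ y (0, 1)) x (0, 1) = -l * φ x)
    (hw : ContDiff ℝ (⊤ : ℕ∞) w) (hc : HasCompactSupport w) :
    ∫ x, gradSq (fun x => φ x * w x) x =
      l * (∫ x, (φ x * w x) ^ 2) + ∫ x, φ x ^ 2 * gradSq w x := by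
  have dφ : Differentiable ℝ φ := hφ.differentiable (by simp)
  have dw : Differentiable ℝ w := hw.differentiable (by simp)
  have hψ : ContDiff ℝ (⊤ : ℕ∞) fun x => φ x * w x ^ 2 := hφ.mul (hw.pow 2)
  have hψc : HasCompactSupport fun x => φ x * w x ^ 2 := hc.sq.mul_left
  have e1 : ∀ x v, fderiv ℝ (fun x => φ x * w x) x v =
      φ x * fderiv ℝ w x v + w x * fderiv ℝ φ x v := fun x v => by
    rw [fderiv_fun_mul (dφ x) (dw x)]; simp
  have e2 : ∀ x v, fderiv ℝ (fun x => φ x * w x ^ 2) x v =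
      2 * φ x * w x * fderiv ℝ w x v + w x ^ 2 * fderiv ℝ φ x v := fun x v => by
    rw [fderiv_fun_mul (dφ x) ((dw x).fun_pow 2), fderiv_fun_pow 2 (dw x)]; simp; ring
  have cψ : ∀ v, HasCompactSupport fun x => fderiv ℝ (fun x => φ x * w x ^ 2) x v := fun v =>
    hψc.mono' fun x hx => by_contra fun h => hx (by
      simp [fderiv_eq_zero_of_notMem_tsupport h])
  have i1 : ∀ v, Integrable fun x => fderiv ℝ φ x v * fderiv ℝ (fun x => φ x * w x ^ 2) x v :=
    fun v => ((contDiff_fderiv_apply hφ v).continuous.mul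
      (contDiff_fderiv_apply hψ v).continuous).integrable_of_hasCompactSupport (cψ v).mul_left
  have i2 : ∀ v, Integrable fun x =>
      fderiv ℝ (fun y => fderiv ℝ φ y v) x v * (φ x * w x ^ 2) := fun v =>
    ((contDiff_fderiv_apply (contDiff_fderiv_apply hφ v) v).continuous.mul
      hψ.continuous).integrable_of_hasCompactSupport hψc.mul_left
  have i3 : ∀ v, Integrable fun x => fderiv ℝ φ x v * (φ x * w x ^ 2) := fun v =>
    ((contDiff_fderiv_apply hφ v).continuous.mul
      hψ.continuous).integrable_of_hasCompactSupport hψc.mul_left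
  have i4 : Integrable fun x => φ x ^ 2 * gradSq w x :=
    ((hφ.continuous.pow 2).mul (continuous_gradSq hw)).integrable_of_hasCompactSupport
      hc.gradSq.mul_left
  have ibp : ∀ v, ∫ x, fderiv ℝ φ x v * fderiv ℝ (fun x => φ x * w x ^ 2) x v =
      -∫ x, fderiv ℝ (fun y => fderiv ℝ φ y v) x v * (φ x * w x ^ 2) := fun v =>
    integral_mul_fderiv_eq_neg_fderiv_mul_of_integrable (i2 v) (i1 v) (i3 v)
      (fun x _ => (contDiff_fderiv_apply hφ v).differentiable (by simp) x)
      (fun x _ => hψ.differentiable (by simp) x)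
  calc ∫ x, gradSq (fun x => φ x * w x) x
      = ∫ x, (fderiv ℝ φ x (1, 0) * fderiv ℝ (fun x => φ x * w x ^ 2) x (1, 0) +
          fderiv ℝ φ x (0, 1) * fderiv ℝ (fun x => φ x * w x ^ 2) x (0, 1)) +
          φ x ^ 2 * gradSq w x := by
        refine integral_congr_ae (.of_forall fun x => ?_)
        simp only [gradSq, e1, e2]
        ring
    _ = (-(∫ x, fderiv ℝ (fun y => fderiv ℝ φ y (1, 0)) x (1, 0) * (φ x * w x ^ 2)) +
          -(∫ x, fderiv ℝ (fun y => fderiv ℝ φ y (0, 1)) x (0, 1) * (φ x * w x ^ 2))) +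
          ∫ x, φ x ^ 2 * gradSq w x := by
        rw [integral_add _ i4, integral_add (i1 _) (i1 _), ibp, ibp]
        exact (i1 _).add (i1 _)
    _ = _ := by
        rw [← neg_add, ← integral_add (i2 _) (i2 _), ← integral_neg, ← integral_const_mul]
        congr 1
        refine integral_congr_ae (.of_forall fun x => ?_)
        linear_combination -(φ x * w x ^ 2) * hlap x

theorem contDiff_comp_normSq {g : ℝ → ℝ} (hg : ContDiff ℝ (⊤ : ℕ∞) g) :
    ContDiff ℝ (⊤ : ℕ∞) fun x : ℝ × ℝ => g (x.1 ^ 2 + x.2 ^ 2) :=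
  hg.comp ((contDiff_fst.pow 2).add (contDiff_snd.pow 2))

theorem hasDerivAt_comp_sq_add {g : ℝ → ℝ} (hg : Differentiable ℝ g) (c t : ℝ) :
    HasDerivAt (fun t => g (t ^ 2 + c)) (2 * t * deriv g (t ^ 2 + c)) t := by
  have h := (hg (t ^ 2 + c)).hasDerivAt.comp t ((hasDerivAt_pow 2 t).add_const c)
  refine h.congr_deriv ?_
  push_cast; ring

theorem hasDerivAt_comp_add_sq {g : ℝ → ℝ} (hg : Differentiable ℝ g) (c t : ℝ) :
    HasDerivAt (fun t => g (c + t ^ 2)) (2 * t * deriv g (c + t ^ 2)) t := by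
  simpa only [add_comm c] using hasDerivAt_comp_sq_add hg c t

theorem laplacian_fst_mul {g : ℝ → ℝ} (hg : ContDiff ℝ (⊤ : ℕ∞) g) {κ : ℝ}
    (ode : ∀ s, s * deriv (deriv g) s + 2 * deriv g s = -κ * g s) (x : ℝ × ℝ) :
    fderiv ℝ (fun y => fderiv ℝ (fun x : ℝ × ℝ => x.1 * g (x.1 ^ 2 + x.2 ^ 2)) y (1, 0)) x (1, 0) +
      fderiv ℝ (fun y => fderiv ℝ (fun x : ℝ × ℝ => x.1 * g (x.1 ^ 2 + x.2 ^ 2)) y (0, 1)) x (0, 1)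
      = -(4 * κ) * (x.1 * g (x.1 ^ 2 + x.2 ^ 2)) := by
  have hφ : ContDiff ℝ (⊤ : ℕ∞) fun x : ℝ × ℝ => x.1 * g (x.1 ^ 2 + x.2 ^ 2) :=
    contDiff_fst.mul (contDiff_comp_normSq hg)
  have d0 : Differentiable ℝ g := hg.differentiable (by simp)
  have d1 : Differentiable ℝ (deriv g) :=
    (contDiff_infty_iff_deriv.1 hg).2.differentiable (by simp)
  have dφ := hφ.differentiable (by simp)
  have e1 : ∀ y : ℝ × ℝ, fderiv ℝ (fun x : ℝ × ℝ => x.1 * g (x.1 ^ 2 + x.2 ^ 2)) y (1, 0) =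
      g (y.1 ^ 2 + y.2 ^ 2) + 2 * y.1 ^ 2 * deriv g (y.1 ^ 2 + y.2 ^ 2) := fun y =>
    fderiv_fst_eq (dφ y) (((hasDerivAt_id y.1).mul (hasDerivAt_comp_sq_add d0 (y.2 ^ 2) y.1)).congr_deriv
      (by simp only [id]; ring))
  have e2 : ∀ y : ℝ × ℝ, fderiv ℝ (fun x : ℝ × ℝ => x.1 * g (x.1 ^ 2 + x.2 ^ 2)) y (0, 1) =
      2 * y.1 * y.2 * deriv g (y.1 ^ 2 + y.2 ^ 2) := fun y =>
    fderiv_snd_eq (dφ y) (((hasDerivAt_comp_add_sq d0 (y.1 ^ 2) y.2).const_mul y.1).congr_deriv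
      (by ring))
  have f1 := fderiv_fst_eq ((contDiff_fderiv_apply hφ (1, 0)).differentiable (by simp) x)
    (d := 6 * x.1 * deriv g (x.1 ^ 2 + x.2 ^ 2) +
      4 * x.1 ^ 3 * deriv (deriv g) (x.1 ^ 2 + x.2 ^ 2)) (by
      simp only [e1]
      refine ((hasDerivAt_comp_sq_add d0 (x.2 ^ 2) x.1).add
        (((hasDerivAt_pow 2 x.1).const_mul 2).mul
          (hasDerivAt_comp_sq_add d1 (x.2 ^ 2) x.1))).congr_deriv ?_
      push_cast; ring)
  have f2 := fderiv_snd_eq ((contDiff_fderiv_apply hφ (0, 1)).differentiable (by simp) x)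
    (d := 2 * x.1 * deriv g (x.1 ^ 2 + x.2 ^ 2) +
      4 * x.1 * x.2 ^ 2 * deriv (deriv g) (x.1 ^ 2 + x.2 ^ 2)) (by
      simp only [e2]
      refine (((hasDerivAt_id x.2).const_mul (2 * x.1)).mul
        (hasDerivAt_comp_add_sq d1 (x.1 ^ 2) x.2)).congr_deriv ?_
      simp only [id]; ring)
  rw [f1, f2]
  linear_combination 4 * x.1 * ode (x.1 ^ 2 + x.2 ^ 2)

theorem laplacian_snd_mul {g : ℝ → ℝ} (hg : ContDiff ℝ (⊤ : ℕ∞) g) {κ : ℝ}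
    (ode : ∀ s, s * deriv (deriv g) s + 2 * deriv g s = -κ * g s) (x : ℝ × ℝ) :
    fderiv ℝ (fun y => fderiv ℝ (fun x : ℝ × ℝ => x.2 * g (x.1 ^ 2 + x.2 ^ 2)) y (1, 0)) x (1, 0) +
      fderiv ℝ (fun y => fderiv ℝ (fun x : ℝ × ℝ => x.2 * g (x.1 ^ 2 + x.2 ^ 2)) y (0, 1)) x (0, 1)
      = -(4 * κ) * (x.2 * g (x.1 ^ 2 + x.2 ^ 2)) := by
  have hφ : ContDiff ℝ (⊤ : ℕ∞) fun x : ℝ × ℝ => x.2 * g (x.1 ^ 2 + x.2 ^ 2) :=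
    contDiff_snd.mul (contDiff_comp_normSq hg)
  have d0 : Differentiable ℝ g := hg.differentiable (by simp)
  have d1 : Differentiable ℝ (deriv g) :=
    (contDiff_infty_iff_deriv.1 hg).2.differentiable (by simp)
  have dφ := hφ.differentiable (by simp)
  have e1 : ∀ y : ℝ × ℝ, fderiv ℝ (fun x : ℝ × ℝ => x.2 * g (x.1 ^ 2 + x.2 ^ 2)) y (1, 0) =
      2 * y.2 * y.1 * deriv g (y.1 ^ 2 + y.2 ^ 2) := fun y =>
    fderiv_fst_eq (dφ y) (((hasDerivAt_comp_sq_add d0 (y.2 ^ 2) y.1).const_mul y.2).congr_deriv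
      (by ring))
  have e2 : ∀ y : ℝ × ℝ, fderiv ℝ (fun x : ℝ × ℝ => x.2 * g (x.1 ^ 2 + x.2 ^ 2)) y (0, 1) =
      g (y.1 ^ 2 + y.2 ^ 2) + 2 * y.2 ^ 2 * deriv g (y.1 ^ 2 + y.2 ^ 2) := fun y =>
    fderiv_snd_eq (dφ y) (((hasDerivAt_id y.2).mul (hasDerivAt_comp_add_sq d0 (y.1 ^ 2) y.2)).congr_deriv
      (by simp only [id]; ring))
  have f1 := fderiv_fst_eq ((contDiff_fderiv_apply hφ (1, 0)).differentiable (by simp) x)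
    (d := 2 * x.2 * deriv g (x.1 ^ 2 + x.2 ^ 2) +
      4 * x.2 * x.1 ^ 2 * deriv (deriv g) (x.1 ^ 2 + x.2 ^ 2)) (by
      simp only [e1]
      refine (((hasDerivAt_id x.1).const_mul (2 * x.2)).mul
        (hasDerivAt_comp_sq_add d1 (x.2 ^ 2) x.1)).congr_deriv ?_
      simp only [id]; ring)
  have f2 := fderiv_snd_eq ((contDiff_fderiv_apply hφ (0, 1)).differentiable (by simp) x)
    (d := 6 * x.2 * deriv g (x.1 ^ 2 + x.2 ^ 2) +
      4 * x.2 ^ 3 * deriv (deriv g) (x.1 ^ 2 + x.2 ^ 2)) (by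
      simp only [e2]
      refine ((hasDerivAt_comp_add_sq d0 (x.1 ^ 2) x.2).add
        (((hasDerivAt_pow 2 x.2).const_mul 2).mul
          (hasDerivAt_comp_add_sq d1 (x.1 ^ 2) x.2))).congr_deriv ?_
      push_cast; ring)
  rw [f1, f2]
  linear_combination 4 * x.2 * ode (x.1 ^ 2 + x.2 ^ 2)

theorem rayleigh_eq {ω : Set (ℝ × ℝ)} {u : ℝ × ℝ → ℝ} (hu : testFun ω u) :
    rayleigh ω u = (∫ x, gradSq u x) / ∫ x, u x ^ 2 := by
  rw [rayleigh, setIntegral_eq_integral_of_forall_compl_eq_zero fun x hx =>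
      gradSq_eq_zero_of_notMem_tsupport fun h => hx (hu.2.2 h),
    setIntegral_eq_integral_of_forall_compl_eq_zero fun x hx => by
      rw [image_eq_zero_of_notMem_tsupport fun h => hx (hu.2.2 h)]; simp]

theorem rayleigh_nonneg (ω : Set (ℝ × ℝ)) (u : ℝ × ℝ → ℝ) : 0 ≤ rayleigh ω u :=
  div_nonneg (integral_nonneg fun x => gradSq_nonneg u x) (integral_nonneg fun _ => sq_nonneg _)

theorem dirichletEV_le {ω : Set (ℝ × ℝ)} {k : ℕ} {c : ℝ} (hk : k ≠ 0)
    (V : Submodule ℝ ((ℝ × ℝ) → ℝ)) (hV : ∀ u ∈ V, testFun ω u) (hdim : Module.finrank ℝ V = k)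
    (h : ∀ u ∈ V, u ≠ 0 → rayleigh ω u ≤ c) : dirichletEV ω k ≤ c := by
  have hle : sSup {r | ∃ u ∈ V, u ≠ 0 ∧ r = rayleigh ω u} ≤ c := by
    refine csSup_le ?_ ?_
    · have : V ≠ ⊥ := by
        rintro rfl
        rw [finrank_bot] at hdim
        exact hk hdim.symm
      obtain ⟨u, hu, hu0⟩ := V.exists_mem_ne_zero_of_ne_bot this
      exact ⟨_, u, hu, hu0, rfl⟩
    · rintro r ⟨u, hu, hu0, rfl⟩
      exact h u hu hu0
  unfold dirichletEV
  refine csInf_le_of_le ⟨0, ?_⟩ ⟨V, hV, hdim, rfl⟩ hle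
  rintro l ⟨V, -, -, rfl⟩
  refine Real.sSup_nonneg ?_
  rintro r ⟨u, -, -, rfl⟩
  exact rayleigh_nonneg ω u

theorem gradSq_const_smul (c : ℝ) (u : ℝ × ℝ → ℝ) (x : ℝ × ℝ) :
    gradSq (c • u) x = c ^ 2 * gradSq u x := by
  simp only [gradSq, fderiv_const_smul_field, smul_apply, smul_eq_mul,
    Pi.smul_apply]
  ring

theorem rayleigh_const_smul (ω : Set (ℝ × ℝ)) {c : ℝ} (hc : c ≠ 0) (u : ℝ × ℝ → ℝ) :
    rayleigh ω (c • u) = rayleigh ω u := by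
  simp only [rayleigh, gradSq_const_smul, Pi.smul_apply, smul_eq_mul, mul_pow, integral_const_mul]
  exact mul_div_mul_left _ _ (pow_ne_zero 2 hc)

theorem testFun.const_smul {ω : Set (ℝ × ℝ)} {u : ℝ × ℝ → ℝ} (hu : testFun ω u) (c : ℝ) :
    testFun ω (c • u) :=
  ⟨hu.1.const_smul c, hu.2.1.smul_left (f := fun _ => c),
    (tsupport_smul_subset_right (fun _ => c) u).trans hu.2.2⟩

theorem testFun.add {ω : Set (ℝ × ℝ)} {u v : ℝ × ℝ → ℝ} (hu : testFun ω u) (hv : testFun ω v) :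
    testFun ω (u + v) :=
  ⟨hu.1.add hv.1, hu.2.1.add hv.2.1, (tsupport_add u v).trans (union_subset hu.2.2 hv.2.2)⟩

theorem testFun.mono {ω ω' : Set (ℝ × ℝ)} {u : ℝ × ℝ → ℝ} (hu : testFun ω u) (h : ω ⊆ ω') :
    testFun ω' u :=
  ⟨hu.1, hu.2.1, hu.2.2.trans h⟩

theorem le_dirichletEV_one {ω : Set (ℝ × ℝ)} {c : ℝ} (hne : ∃ u, testFun ω u ∧ u ≠ 0)
    (h : ∀ u, testFun ω u → u ≠ 0 → c ≤ rayleigh ω u) : c ≤ dirichletEV ω 1 := by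
  refine le_csInf ?_ ?_
  · obtain ⟨u, hu, hu0⟩ := hne
    refine ⟨_, Submodule.span ℝ {u}, fun v hv => ?_, finrank_span_singleton hu0, rfl⟩
    obtain ⟨a, rfl⟩ := Submodule.mem_span_singleton.1 hv
    exact hu.const_smul a
  · rintro l ⟨V, hV, hdim, rfl⟩
    obtain ⟨⟨u, hu⟩, hu0, hspan⟩ := finrank_eq_one_iff'.1 hdim
    have hu0' : u ≠ 0 := fun h0 => hu0 (Subtype.ext h0)
    refine (h u (hV hu) hu0').trans (le_csSup ⟨rayleigh ω u, ?_⟩ ⟨u, hu, hu0', rfl⟩)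
    rintro r ⟨v, hv, hv0, rfl⟩
    obtain ⟨a, ha⟩ := hspan ⟨v, hv⟩
    have hav : a • u = v := congrArg Subtype.val ha
    subst hav
    have ha0 : a ≠ 0 := by rintro rfl; simp at hv0
    exact (rayleigh_const_smul ω ha0 u).le

/-- The reflection across the vertical axis. -/
def reflectFst : (ℝ × ℝ) ≃L[ℝ] (ℝ × ℝ) :=
  (ContinuousLinearEquiv.neg ℝ).prodCongr (ContinuousLinearEquiv.refl ℝ ℝ)

theorem reflectFst_apply (x : ℝ × ℝ) : reflectFst x = (-x.1, x.2) := rfl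

theorem measurePreserving_reflectFst : MeasurePreserving reflectFst :=
  (Measure.measurePreserving_neg (volume : Measure ℝ)).prod (MeasurePreserving.id volume)

theorem gradSq_comp_reflectFst (u : ℝ × ℝ → ℝ) (x : ℝ × ℝ) :
    gradSq (u ∘ reflectFst) x = gradSq u (reflectFst x) := by
  have h1 : reflectFst ((1, 0) : ℝ × ℝ) = -(1, 0) := by simp [reflectFst_apply]
  have h2 : reflectFst ((0, 1) : ℝ × ℝ) = (0, 1) := by simp [reflectFst_apply]
  simp only [gradSq, reflectFst.comp_right_fderiv, ContinuousLinearMap.comp_apply,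
    ContinuousLinearEquiv.coe_coe, h1, h2, map_neg]
  ring

theorem integral_comp_reflectFst (f : ℝ × ℝ → ℝ) : ∫ x, f (reflectFst x) = ∫ x, f x :=
  measurePreserving_reflectFst.integral_comp
    reflectFst.toHomeomorph.measurableEmbedding f

theorem tsupport_comp_reflectFst (u : ℝ × ℝ → ℝ) :
    tsupport (u ∘ reflectFst) = reflectFst ⁻¹' tsupport u :=
  tsupport_comp_eq_preimage u reflectFst.toHomeomorph

theorem testFun.comp_reflectFst {ω : Set (ℝ × ℝ)} {u : ℝ × ℝ → ℝ} (hu : testFun ω u) :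
    testFun (reflectFst ⁻¹' ω) (u ∘ reflectFst) :=
  ⟨hu.1.comp reflectFst.contDiff, hu.2.1.comp_homeomorph reflectFst.toHomeomorph, by
    rw [tsupport_comp_reflectFst]; exact preimage_mono hu.2.2⟩

theorem gradSq_smul_add_smul_of_disjoint {u v : ℝ × ℝ → ℝ} (hu : Differentiable ℝ u)
    (hv : Differentiable ℝ v) (hd : Disjoint (tsupport u) (tsupport v)) (a b : ℝ) (x : ℝ × ℝ) :
    gradSq (a • u + b • v) x = a ^ 2 * gradSq u x + b ^ 2 * gradSq v x := by
  have e : fderiv ℝ (a • u + b • v) x = a • fderiv ℝ u x + b • fderiv ℝ v x := by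
    rw [fderiv_add ((hu x).const_smul a) ((hv x).const_smul b), fderiv_const_smul (hu x),
      fderiv_const_smul (hv x)]
  simp only [gradSq, e]
  by_cases hx : x ∈ tsupport u
  · simp [fderiv_eq_zero_of_notMem_tsupport (disjoint_left.1 hd hx)]; ring
  · simp [fderiv_eq_zero_of_notMem_tsupport hx]; ring

theorem dirichletEV_two_le {ω : Set (ℝ × ℝ)} (hω : reflectFst ⁻¹' ω = ω) {u : ℝ × ℝ → ℝ}
    (hu : testFun (ω ∩ {x | 0 < x.1}) u) (hu0 : u ≠ 0) :
    dirichletEV ω 2 ≤ (∫ x, gradSq u x) / ∫ x, u x ^ 2 := by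
  set v := u ∘ reflectFst with hv
  have hvt : testFun (ω ∩ {x | x.1 < 0}) v := by
    refine hu.comp_reflectFst.mono ?_
    rw [preimage_inter, hω]
    rintro x ⟨hx, hx'⟩
    exact ⟨hx, by simpa [reflectFst_apply] using hx'⟩
  have hdisj : Disjoint (tsupport u) (tsupport v) := by
    refine disjoint_left.2 fun x hx hx' => ?_
    have h1 : 0 < x.1 := (hu.2.2 hx).2
    have h2 : x.1 < 0 := (hvt.2.2 hx').2
    linarith
  have huω : testFun ω u := hu.mono inter_subset_left
  have hvω : testFun ω v := hvt.mono inter_subset_left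
  have hzero : ∀ x, u x * v x = 0 := fun x => by
    by_cases hx : x ∈ tsupport u
    · rw [image_eq_zero_of_notMem_tsupport (disjoint_left.1 hdisj hx), mul_zero]
    · rw [image_eq_zero_of_notMem_tsupport hx, zero_mul]
  have hlin : LinearIndependent ℝ ![u, v] := by
    rw [LinearIndependent.pair_iff]
    intro s t hst
    obtain ⟨x, hx⟩ := Function.ne_iff.1 hu0
    have hvx : v x = 0 := (mul_eq_zero.1 (hzero x)).resolve_left hx
    have hvy : v (reflectFst x) = u x := by simp [hv, reflectFst_apply]
    have huy : u (reflectFst x) = 0 :=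
      (mul_eq_zero.1 (hzero (reflectFst x))).resolve_right (by rw [hvy]; exact hx)
    have h1 := congrFun hst x
    have h2 := congrFun hst (reflectFst x)
    simp only [Pi.add_apply, Pi.smul_apply, smul_eq_mul, hvx, hvy, huy, Pi.zero_apply, mul_zero,
      add_zero, zero_add, mul_eq_zero] at h1 h2
    exact ⟨h1.resolve_right hx, h2.resolve_right hx⟩
  have hgu := integrable_gradSq hu.1 hu.2.1
  have hgv := integrable_gradSq hvt.1 hvt.2.1
  have hsu := integrable_sq hu.1.continuous hu.2.1
  have hsv := integrable_sq hvt.1.continuous hvt.2.1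
  have Egv : ∫ x, gradSq v x = ∫ x, gradSq u x := by
    simp only [hv, gradSq_comp_reflectFst]
    exact integral_comp_reflectFst (gradSq u)
  have Esv : ∫ x, v x ^ 2 = ∫ x, u x ^ 2 := integral_comp_reflectFst fun x => u x ^ 2
  have hmem : ∀ f ∈ Submodule.span ℝ (range ![u, v]), ∃ a b : ℝ, f = a • u + b • v := by
    intro f hf
    simp only [Matrix.range_cons, Matrix.range_empty, union_empty] at hf
    obtain ⟨a, b, rfl⟩ := Submodule.mem_span_pair.1 hf
    exact ⟨a, b, rfl⟩
  refine dirichletEV_le two_ne_zero (Submodule.span ℝ (range ![u, v])) ?_ ?_ ?_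
  · intro f hf
    obtain ⟨a, b, rfl⟩ := hmem f hf
    exact (huω.const_smul a).add (hvω.const_smul b)
  · simpa using finrank_span_eq_card hlin
  · intro f hf hf0
    obtain ⟨a, b, rfl⟩ := hmem f hf
    have hab : a ^ 2 + b ^ 2 ≠ 0 := by
      intro h
      have ha : a = 0 := by nlinarith [sq_nonneg a, sq_nonneg b]
      have hb : b = 0 := by nlinarith [sq_nonneg a, sq_nonneg b]
      simp [ha, hb] at hf0
    rw [rayleigh_eq ((huω.const_smul a).add (hvω.const_smul b))]
    have h1 : ∫ x, gradSq (a • u + b • v) x = (a ^ 2 + b ^ 2) * ∫ x, gradSq u x := by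
      simp only [gradSq_smul_add_smul_of_disjoint (hu.1.differentiable (by simp))
        (hvt.1.differentiable (by simp)) hdisj]
      rw [integral_add (hgu.const_mul _) (hgv.const_mul _), integral_const_mul,
        integral_const_mul, Egv]
      ring
    have h2 : ∫ x, (a • u + b • v) x ^ 2 = (a ^ 2 + b ^ 2) * ∫ x, u x ^ 2 := by
      have : ∀ x, (a • u + b • v) x ^ 2 = a ^ 2 * u x ^ 2 + b ^ 2 * v x ^ 2 := fun x => by
        simp only [Pi.add_apply, Pi.smul_apply, smul_eq_mul]
        linear_combination 2 * a * b * hzero x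
      simp only [this]
      rw [integral_add (hsu.const_mul _) (hsv.const_mul _), integral_const_mul,
        integral_const_mul, Esv]
      ring
    rw [h1, h2, mul_div_mul_left _ _ hab]

theorem sq_integral_le {f : ℝ → ℝ} (hf : Continuous f) {a b : ℝ} (hab : a ≤ b) :
    (∫ x in a..b, f x) ^ 2 ≤ (b - a) * ∫ x in a..b, f x ^ 2 := by
  have key : ∀ m : ℝ, 0 ≤ (b - a) * (m * m) + (-2 * ∫ x in a..b, f x) * m +
      ∫ x in a..b, f x ^ 2 := by
    intro m
    have h0 : 0 ≤ ∫ x in a..b, (m - f x) ^ 2 :=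
      intervalIntegral.integral_nonneg hab fun x _ => sq_nonneg _
    have e : ∀ x, (m - f x) ^ 2 = m * m + (-2 * m) * f x + f x ^ 2 := fun x => by ring
    simp only [e] at h0
    rw [intervalIntegral.integral_add (by apply Continuous.intervalIntegrable; fun_prop)
        (by apply Continuous.intervalIntegrable; fun_prop),
      intervalIntegral.integral_add (by apply Continuous.intervalIntegrable; fun_prop)
        (by apply Continuous.intervalIntegrable; fun_prop),
      intervalIntegral.integral_const, intervalIntegral.integral_const_mul, smul_eq_mul] at h0
    linarith
  have := discrim_le_zero key
  rw [discrim] at this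
  nlinarith

theorem weighted_poincare {a b c M : ℝ} (hc : c ∈ Icc a b) (hM0 : 0 ≤ M) {p h h' : ℝ → ℝ}
    (hp : Continuous p) (hp0 : ∀ s ∈ Icc a b, 0 ≤ p s)
    (hM : ∀ t ∈ Icc a b, ∀ s ∈ uIcc c t, p t ≤ M * p s)
    (hh : ∀ s, HasDerivAt h (h' s) s) (hh' : Continuous h') :
    ∫ t in a..b, p t * (h t - h c) ^ 2 ≤ M * (b - a) ^ 2 * ∫ t in a..b, p t * h' t ^ 2 := by
  have hab : a ≤ b := hc.1.trans hc.2
  have hcont : Continuous h := continuous_iff_continuousAt.2 fun s => (hh s).continuousAt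
  have hpt : ∀ t ∈ Icc a b,
      p t * (h t - h c) ^ 2 ≤ M * (b - a) * ∫ t in a..b, p t * h' t ^ 2 := by
    intro t ht
    set x := min c t
    set y := max c t
    have hxy : x ≤ y := min_le_max
    have hax : a ≤ x := le_min hc.1 ht.1
    have hyb : y ≤ b := max_le hc.2 ht.2
    have e1 : (h t - h c) ^ 2 = (h y - h x) ^ 2 := by
      rcases le_total c t with hct | hct <;> simp [x, y, hct]
      ring
    have e2 : ∫ s in x..y, h' s = h y - h x :=
      intervalIntegral.integral_eq_sub_of_hasDerivAt (fun s _ => hh s)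
        (hh'.intervalIntegrable _ _)
    have h1 : (h y - h x) ^ 2 ≤ (b - a) * ∫ s in x..y, h' s ^ 2 := by
      rw [← e2]
      refine (sq_integral_le hh' hxy).trans ?_
      have : 0 ≤ ∫ s in x..y, h' s ^ 2 :=
        intervalIntegral.integral_nonneg hxy fun _ _ => sq_nonneg _
      gcongr
    have h2 : p t * ∫ s in x..y, h' s ^ 2 ≤ M * ∫ s in a..b, p s * h' s ^ 2 := by
      rw [← intervalIntegral.integral_const_mul, ← intervalIntegral.integral_const_mul]
      calc ∫ s in x..y, p t * h' s ^ 2 ≤ ∫ s in x..y, M * (p s * h' s ^ 2) := by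
            refine intervalIntegral.integral_mono_on hxy
              (by apply Continuous.intervalIntegrable; fun_prop)
              (by apply Continuous.intervalIntegrable; fun_prop) fun s hs => ?_
            rw [← mul_assoc]
            exact mul_le_mul_of_nonneg_right (hM t ht s hs) (sq_nonneg _)
        _ ≤ ∫ s in a..b, M * (p s * h' s ^ 2) := by
            refine intervalIntegral.integral_mono_interval hax hxy hyb ?_
              (by apply Continuous.intervalIntegrable; fun_prop)
            refine (ae_restrict_iff' measurableSet_Ioc).2 (.of_forall fun s hs => ?_)
            exact mul_nonneg hM0 (mul_nonneg (hp0 s ⟨hs.1.le, hs.2⟩) (sq_nonneg _))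
    rw [e1]
    calc p t * (h y - h x) ^ 2 ≤ p t * ((b - a) * ∫ s in x..y, h' s ^ 2) :=
          mul_le_mul_of_nonneg_left h1 (hp0 t ht)
      _ = (b - a) * (p t * ∫ s in x..y, h' s ^ 2) := by ring
      _ ≤ (b - a) * (M * ∫ s in a..b, p s * h' s ^ 2) :=
          mul_le_mul_of_nonneg_left h2 (sub_nonneg.2 hab)
      _ = _ := by ring
  calc ∫ t in a..b, p t * (h t - h c) ^ 2
      ≤ ∫ _ in a..b, M * (b - a) * ∫ t in a..b, p t * h' t ^ 2 :=
        intervalIntegral.integral_mono_on hab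
          (by apply Continuous.intervalIntegrable; fun_prop)
          intervalIntegrable_const hpt
    _ = _ := by rw [intervalIntegral.integral_const, smul_eq_mul]; ring

theorem weighted_poincare_of_vanish_on_segment {R ρ α β M : ℝ} (hρ : ρ ∈ Icc 0 R) (hα : 0 ≤ α)
    (hαβ : α ≤ β) (hβ : β ≤ π) (hM0 : 0 ≤ M) {p q : ℝ → ℝ} {W Wr Wθ : ℝ → ℝ → ℝ}
    (hp : Continuous p) (hq : Continuous q) (hp0 : ∀ r ∈ Icc 0 R, 0 ≤ p r)
    (hq0 : ∀ θ ∈ Icc 0 π, 0 ≤ q θ) (hq1 : ∀ θ ∈ Icc 0 π, q θ ≤ 1)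
    (hqαβ : ∀ θ ∈ Icc α β, 1 / 2 ≤ q θ)
    (hpM : ∀ t ∈ Icc 0 R, ∀ s ∈ uIcc ρ t, p t ≤ M * p s)
    (hqM : ∀ θ₀ ∈ Icc α β, ∀ t ∈ Icc 0 π, ∀ s ∈ uIcc θ₀ t, q t ≤ 2 * q s)
    (hW : Continuous (Function.uncurry W)) (hWr : Continuous (Function.uncurry Wr))
    (hWθ : Continuous (Function.uncurry Wθ))
    (dr : ∀ r θ, HasDerivAt (fun r => W r θ) (Wr r θ) r)
    (dθ : ∀ r θ, HasDerivAt (fun θ => W r θ) (Wθ r θ) θ)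
    (hzero : ∀ θ ∈ Icc α β, W ρ θ = 0) :
    (β - α) * (∫ r in 0..R, ∫ θ in 0..π, p r * q θ * W r θ ^ 2) ≤
      4 * π ^ 3 * (∫ r in 0..R, ∫ θ in 0..π, p r * q θ * Wθ r θ ^ 2) +
      4 * π * M * R ^ 2 * ∫ r in 0..R, ∫ θ in 0..π, p r * q θ * Wr r θ ^ 2 := by
  have hR : 0 ≤ R := hρ.1.trans hρ.2
  have hpi : 0 ≤ π := pi_pos.le
  have cr : ∀ {F : ℝ → ℝ → ℝ}, Continuous (Function.uncurry F) → ∀ θ, Continuous fun r => F r θ :=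
    fun hF θ => hF.comp (by fun_prop : Continuous fun r : ℝ => (r, θ))
  have cθ : ∀ {F : ℝ → ℝ → ℝ}, Continuous (Function.uncurry F) → ∀ r, Continuous fun θ => F r θ :=
    fun hF r => hF.comp (by fun_prop : Continuous fun θ : ℝ => (r, θ))
  have cw : ∀ {F : ℝ → ℝ → ℝ}, Continuous (Function.uncurry F) →
      Continuous (Function.uncurry fun r θ => p r * q θ * F r θ ^ 2) := fun {F} hF =>
    ((hp.comp continuous_fst).mul (hq.comp continuous_snd)).mul (hF.pow 2)
  have ci : ∀ {F : ℝ → ℝ → ℝ}, Continuous (Function.uncurry F) →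
      Continuous fun r => ∫ θ in 0..π, F r θ := fun hF =>
    intervalIntegral.continuous_parametric_intervalIntegral_of_continuous hF continuous_const
  set I := ∫ r in 0..R, ∫ θ in 0..π, p r * q θ * W r θ ^ 2
  set Jθ := ∫ r in 0..R, ∫ θ in 0..π, p r * q θ * Wθ r θ ^ 2 with hJθ
  set Jr := ∫ r in 0..R, ∫ θ in 0..π, p r * q θ * Wr r θ ^ 2 with hJr
  have hJθ0 : 0 ≤ Jθ := intervalIntegral.integral_nonneg hR fun r hr =>
    intervalIntegral.integral_nonneg hpi fun θ hθ =>
      mul_nonneg (mul_nonneg (hp0 r hr) (hq0 θ hθ)) (sq_nonneg _)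
  have hslice : ∀ θ₀ ∈ Icc α β,
      I ≤ 4 * π ^ 2 * Jθ + 4 * π * M * R ^ 2 * ∫ r in 0..R, p r * q θ₀ * Wr r θ₀ ^ 2 := by
    intro θ₀ hθ₀
    have hθ₀' : θ₀ ∈ Icc 0 π := ⟨hα.trans hθ₀.1, hθ₀.2.trans hβ⟩
    have cW := cθ hW
    have cWr := cr hWr θ₀
    have cW0 := cr hW θ₀
    have inner : ∀ r ∈ Icc 0 R, ∫ θ in 0..π, p r * q θ * W r θ ^ 2 ≤
        4 * π ^ 2 * (∫ θ in 0..π, p r * q θ * Wθ r θ ^ 2) + 2 * π * (p r * W r θ₀ ^ 2) := by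
      intro r hr
      have cWθ := cθ hWθ r
      have cWr' := cW r
      have h1 := weighted_poincare hθ₀' zero_le_two hq hq0 (hqM θ₀ hθ₀) (dθ r) cWθ
      rw [sub_zero] at h1
      have h2 : ∫ θ in 0..π, q θ * W r θ ^ 2 ≤
          2 * (∫ θ in 0..π, q θ * (W r θ - W r θ₀) ^ 2) + 2 * W r θ₀ ^ 2 * π := by
        calc ∫ θ in 0..π, q θ * W r θ ^ 2
            ≤ ∫ θ in 0..π, 2 * (q θ * (W r θ - W r θ₀) ^ 2) + 2 * W r θ₀ ^ 2 := by
              refine intervalIntegral.integral_mono_on hpi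
                (by apply Continuous.intervalIntegrable; fun_prop)
                (by apply Continuous.intervalIntegrable; fun_prop) fun θ hθ => ?_
              have a1 := mul_nonneg (hq0 θ hθ) (sq_nonneg (W r θ - 2 * W r θ₀))
              have a2 := mul_nonneg (sub_nonneg.2 (hq1 θ hθ)) (sq_nonneg (W r θ₀))
              nlinarith
          _ = _ := by
              rw [intervalIntegral.integral_add (by apply Continuous.intervalIntegrable; fun_prop)
                intervalIntegrable_const, intervalIntegral.integral_const_mul,
                intervalIntegral.integral_const, smul_eq_mul]
              ring
      have e1 : ∫ θ in 0..π, p r * q θ * W r θ ^ 2 = p r * ∫ θ in 0..π, q θ * W r θ ^ 2 := by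
        rw [← intervalIntegral.integral_const_mul]; simp only [mul_assoc]
      have e2 : ∫ θ in 0..π, p r * q θ * Wθ r θ ^ 2 = p r * ∫ θ in 0..π, q θ * Wθ r θ ^ 2 := by
        rw [← intervalIntegral.integral_const_mul]; simp only [mul_assoc]
      rw [e1, e2]
      calc p r * ∫ θ in 0..π, q θ * W r θ ^ 2
          ≤ p r * (4 * π ^ 2 * (∫ θ in 0..π, q θ * Wθ r θ ^ 2) + 2 * π * W r θ₀ ^ 2) := by
            refine mul_le_mul_of_nonneg_left ?_ (hp0 r hr)
            linarith
        _ = _ := by ring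
    have radial : ∫ r in 0..R, p r * W r θ₀ ^ 2 ≤
        2 * M * R ^ 2 * ∫ r in 0..R, p r * q θ₀ * Wr r θ₀ ^ 2 := by
      have h1 := weighted_poincare hρ hM0 hp hp0 hpM (fun r => dr r θ₀) cWr
      simp only [hzero θ₀ hθ₀, sub_zero] at h1
      have h2 : ∫ r in 0..R, p r * q θ₀ * Wr r θ₀ ^ 2 = q θ₀ * ∫ r in 0..R, p r * Wr r θ₀ ^ 2 := by
        rw [← intervalIntegral.integral_const_mul]
        refine intervalIntegral.integral_congr fun r _ => ?_
        ring
      have h3 : 0 ≤ ∫ r in 0..R, p r * Wr r θ₀ ^ 2 := intervalIntegral.integral_nonneg hR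
        fun r hr => mul_nonneg (hp0 r hr) (sq_nonneg _)
      rw [h2]
      have h4 := mul_le_mul_of_nonneg_right (hqαβ θ₀ hθ₀) h3
      have h5 : 0 ≤ M * R ^ 2 := by positivity
      nlinarith
    have cP : Continuous fun r => p r * W r θ₀ ^ 2 := by fun_prop
    calc I ≤ ∫ r in 0..R, (4 * π ^ 2 * (∫ θ in 0..π, p r * q θ * Wθ r θ ^ 2) +
            2 * π * (p r * W r θ₀ ^ 2)) := by
          refine intervalIntegral.integral_mono_on hR ((ci (cw hW)).intervalIntegrable _ _) ?_ inner
          exact (((ci (cw hWθ)).const_mul _).add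
            (cP.const_mul _)).intervalIntegrable _ _
      _ = 4 * π ^ 2 * Jθ + 2 * π * ∫ r in 0..R, p r * W r θ₀ ^ 2 := by
          rw [intervalIntegral.integral_add (((ci (cw hWθ)).const_mul _).intervalIntegrable _ _)
            ((cP.const_mul _).intervalIntegrable _ _),
            intervalIntegral.integral_const_mul, intervalIntegral.integral_const_mul]
      _ ≤ _ := by nlinarith [pi_pos]
  have hswap : Jr = ∫ θ in 0..π, ∫ r in 0..R, p r * q θ * Wr r θ ^ 2 :=
    intervalIntegral_intervalIntegral_swap
      (((cw hWr).continuousOn.integrableOn_compact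
        (isCompact_uIcc.prod isCompact_uIcc)).mono_set
          (prod_mono uIoc_subset_uIcc uIoc_subset_uIcc))
  have cS : Continuous fun θ => ∫ r in 0..R, p r * q θ * Wr r θ ^ 2 :=
    intervalIntegral.continuous_parametric_intervalIntegral_of_continuous
      (f := fun θ r => p r * q θ * Wr r θ ^ 2) ((cw hWr).comp continuous_swap) continuous_const
  have hJr' : ∫ θ in α..β, ∫ r in 0..R, p r * q θ * Wr r θ ^ 2 ≤ Jr := by
    rw [hswap]
    refine intervalIntegral.integral_mono_interval hα hαβ hβ ?_ (cS.intervalIntegrable _ _)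
    refine (ae_restrict_iff' measurableSet_Ioc).2 (.of_forall fun θ hθ => ?_)
    exact intervalIntegral.integral_nonneg hR fun r hr =>
      mul_nonneg (mul_nonneg (hp0 r hr) (hq0 θ ⟨hθ.1.le, hθ.2⟩)) (sq_nonneg _)
  have h_integ : ∫ _ in α..β, I ≤ ∫ θ in α..β, (4 * π ^ 2 * Jθ +
      4 * π * M * R ^ 2 * ∫ r in 0..R, p r * q θ * Wr r θ ^ 2) :=
    intervalIntegral.integral_mono_on hαβ intervalIntegrable_const
      ((continuous_const.add (cS.const_mul _)).intervalIntegrable _ _) hslice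
  rw [intervalIntegral.integral_add intervalIntegrable_const
    ((cS.const_mul _).intervalIntegrable _ _), intervalIntegral.integral_const,
    intervalIntegral.integral_const, intervalIntegral.integral_const_mul, smul_eq_mul,
    smul_eq_mul] at h_integ
  have h1 : (β - α) * (4 * π ^ 2 * Jθ) ≤ π * (4 * π ^ 2 * Jθ) := by
    refine mul_le_mul_of_nonneg_right (by linarith) (by positivity)
  have h2 : 4 * π * M * R ^ 2 * ∫ θ in α..β, ∫ r in 0..R, p r * q θ * Wr r θ ^ 2 ≤
      4 * π * M * R ^ 2 * Jr := mul_le_mul_of_nonneg_left hJr' (by positivity)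
  linarith

theorem integral_eq_polar {R : ℝ} (hR : 0 ≤ R) {F : ℝ × ℝ → ℝ} (hF : Continuous F)
    (h0 : ∀ x ∉ halfDisk R, F x = 0) :
    ∫ x, F x = ∫ r in 0..R, ∫ θ in 0..π, r * F (r * cos θ, r * sin θ) := by
  have hc : Continuous fun p : ℝ × ℝ => p.1 * F (p.1 * cos p.2, p.1 * sin p.2) := by fun_prop
  rw [← integral_comp_polarCoord_symm]
  simp only [polarCoord_symm_apply, smul_eq_mul]
  have hsub : Ioo (0 : ℝ) R ×ˢ Ioo (0 : ℝ) π ⊆ polarCoord.target := by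
    rintro ⟨r, θ⟩ ⟨hr, hθ⟩
    exact ⟨hr.1, (neg_lt_zero.2 pi_pos).trans hθ.1, hθ.2⟩
  rw [setIntegral_eq_of_subset_of_forall_sdiff_eq_zero polarCoord.open_target.measurableSet hsub]
  · rw [Measure.volume_eq_prod, setIntegral_prod, intervalIntegral.integral_of_le hR,
      integral_Ioc_eq_integral_Ioo]
    · simp only [intervalIntegral.integral_of_le pi_pos.le, integral_Ioc_eq_integral_Ioo]
    · exact (hc.continuousOn.integrableOn_compact
        ((isCompact_Icc (a := (0 : ℝ)) (b := R)).prod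
          (isCompact_Icc (a := (0 : ℝ)) (b := π)))).mono_set
        (prod_mono Ioo_subset_Icc_self Ioo_subset_Icc_self)
  · rintro ⟨r, θ⟩ ⟨⟨hr, hθ⟩, hnot⟩
    simp only [mem_Ioi] at hr
    have : F (r * cos θ, r * sin θ) = 0 := by
      refine h0 _ fun hx => hnot ?_
      obtain ⟨h1, h2⟩ := hx
      simp only [disk, mem_ofPred_eq] at h1 h2
      have h3 : r ^ 2 < R ^ 2 := by nlinarith [sin_sq_add_cos_sq θ]
      refine ⟨⟨hr, lt_of_pow_lt_pow_left₀ 2 hR h3⟩, ?_, hθ.2⟩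
      by_contra! hle
      have := sin_nonpos_of_nonpos_of_neg_pi_le hle hθ.1.le
      nlinarith
    simp [this]

theorem exists_eq_mul_of_ne_zero {u φ : ℝ × ℝ → ℝ} (hu : ContDiff ℝ (⊤ : ℕ∞) u)
    (hφ : ContDiff ℝ (⊤ : ℕ∞) φ) (h : ∀ x ∈ tsupport u, φ x ≠ 0) :
    ∃ w : ℝ × ℝ → ℝ, ContDiff ℝ (⊤ : ℕ∞) w ∧ (∀ x, u x = φ x * w x) ∧
      ∀ x, u x = 0 → w x = 0 := by
  refine ⟨fun x => u x / φ x, contDiff_iff_contDiffAt.2 fun x => ?_, fun x => ?_, fun x hx => ?_⟩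
  · by_cases hx : x ∈ tsupport u
    · exact hu.contDiffAt.div hφ.contDiffAt (h x hx)
    · have : (fun x => u x / φ x) =ᶠ[nhds x] fun _ => 0 := by
        filter_upwards [notMem_tsupport_iff_eventuallyEq.1 hx] with y hy
        simp [hy]
      exact contDiffAt_const.congr_of_eventuallyEq this
  · by_cases hx : u x = 0
    · simp [hx]
    · field_simp [h x (subset_tsupport _ hx)]
  · simp [hx]

theorem one_half_le_sin_sq {θ : ℝ} (h : θ ∈ Icc (π / 4) (3 * π / 4)) : 1 / 2 ≤ sin θ ^ 2 := by
  have : cos (2 * θ) ≤ 0 := cos_nonpos_of_pi_div_two_le_of_le (by linarith [h.1])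
    (by linarith [h.2])
  rw [sin_sq_eq_half_sub]
  linarith

theorem sin_sq_le_two_mul_sin_sq {θ t s : ℝ} (hθ : θ ∈ Icc (π / 4) (3 * π / 4))
    (ht : t ∈ Icc 0 π) (hs : s ∈ uIcc θ t) : sin t ^ 2 ≤ 2 * sin s ^ 2 := by
  have hpi := pi_pos
  have h0 := sin_nonneg_of_nonneg_of_le_pi ht.1 ht.2
  by_cases hsm : s ∈ Icc (π / 4) (3 * π / 4)
  · linarith [one_half_le_sin_sq hsm, sin_sq_le_one t]
  · have : sin t ≤ sin s := by
      rcases le_total θ t with hc | hc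
      · rw [uIcc_of_le hc] at hs
        have h1 : 3 * π / 4 < s := by
          by_contra! h
          exact hsm ⟨hθ.1.trans hs.1, h⟩
        rw [← sin_pi_sub t, ← sin_pi_sub s]
        exact sin_le_sin_of_le_of_le_pi_div_two (by linarith [ht.2]) (by linarith)
          (by linarith [hs.2])
      · rw [uIcc_of_ge hc] at hs
        have h1 : s < π / 4 := by
          by_contra! h
          exact hsm ⟨h, hs.2.trans hθ.2⟩
        exact sin_le_sin_of_le_of_le_pi_div_two (by linarith [ht.1]) (by linarith) hs.1
    nlinarith

theorem IsRadialFactor.nonneg {R κ : ℝ} {g : ℝ → ℝ} (hg : IsRadialFactor R κ g) {s : ℝ}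
    (hs : s ∈ Icc 0 (R ^ 2)) : 0 ≤ g s := by
  rcases hs.2.lt_or_eq with h | h
  · exact (hg.pos s ⟨hs.1, h⟩).le
  · rw [h, hg.zero]

theorem IsRadialFactor.exists_weight_bound {R κ R₁ : ℝ} {g : ℝ → ℝ} (hg : IsRadialFactor R κ g)
    (hR₁ : 0 < R₁) (h : R₁ < R) : ∃ M, 0 ≤ M ∧ ∀ t ∈ Icc 0 R, ∀ s ∈ uIcc R₁ t,
      t ^ 3 * g (t ^ 2) ^ 2 ≤ M * (s ^ 3 * g (s ^ 2) ^ 2) := by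
  have sq : ∀ {x : ℝ}, x ∈ Icc 0 R → x ^ 2 ∈ Icc 0 (R ^ 2) := fun hx =>
    ⟨sq_nonneg _, pow_le_pow_left₀ hx.1 hx.2 2⟩
  have hR : 0 < R := hR₁.trans h
  have h1R : R₁ ∈ Icc 0 R := ⟨hR₁.le, h.le⟩
  have hg1 : 0 < g (R₁ ^ 2) := hg.pos _ ⟨sq_nonneg _, pow_lt_pow_left₀ h hR₁.le two_ne_zero⟩
  have h0R : (0 : ℝ) ∈ Icc 0 (R ^ 2) := ⟨le_rfl, sq_nonneg _⟩
  have hg0 : 0 ≤ g 0 := hg.nonneg h0R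
  refine ⟨(g 0 / g (R₁ ^ 2)) ^ 2 + (R / R₁) ^ 3, by positivity, fun t ht s hs => ?_⟩
  have hgt := hg.nonneg (sq ht)
  rcases le_total R₁ t with hc | hc
  · rw [uIcc_of_le hc] at hs
    have hsR : s ∈ Icc 0 R := ⟨hR₁.le.trans hs.1, hs.2.trans ht.2⟩
    have hs0 := hsR.1
    have ht0 := ht.1
    have e1 : t ≤ R / R₁ * s := by
      rw [div_mul_eq_mul_div, le_div_iff₀ hR₁]
      exact mul_le_mul ht.2 hs.1 hR₁.le hR.le
    have e2 : g (t ^ 2) ≤ g (s ^ 2) :=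
      hg.anti (sq hsR) (sq ht) (pow_le_pow_left₀ hs0 hs.2 2)
    calc t ^ 3 * g (t ^ 2) ^ 2 ≤ (R / R₁ * s) ^ 3 * g (s ^ 2) ^ 2 := by gcongr
      _ = (R / R₁) ^ 3 * (s ^ 3 * g (s ^ 2) ^ 2) := by ring
      _ ≤ _ := by
        gcongr
        exact le_add_of_nonneg_left (sq_nonneg _)
  · rw [uIcc_of_ge hc] at hs
    have hsR : s ∈ Icc 0 R := ⟨ht.1.trans hs.1, hs.2.trans h.le⟩
    have hs0 := hsR.1
    have ht0 := ht.1
    have e1 : g (t ^ 2) ≤ g 0 := hg.anti h0R (sq ht) (sq_nonneg _)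
    have e2 : g (R₁ ^ 2) ≤ g (s ^ 2) :=
      hg.anti (sq hsR) (sq h1R) (pow_le_pow_left₀ hs0 hs.2 2)
    have e3 : g (t ^ 2) ≤ g 0 / g (R₁ ^ 2) * g (s ^ 2) := by
      refine e1.trans ?_
      rw [div_mul_eq_mul_div, le_div_iff₀ hg1]
      exact mul_le_mul_of_nonneg_left e2 hg0
    have hst := hs.1
    calc t ^ 3 * g (t ^ 2) ^ 2 ≤ s ^ 3 * (g 0 / g (R₁ ^ 2) * g (s ^ 2)) ^ 2 := by gcongr
      _ = (g 0 / g (R₁ ^ 2)) ^ 2 * (s ^ 3 * g (s ^ 2) ^ 2) := by ring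
      _ ≤ _ := by
        gcongr
        exact le_add_of_nonneg_right (by positivity)

theorem polar_mem_crackSetPlus {R₁ δ θ : ℝ} (hR₁ : 0 < R₁) (hδ : δ < π / 4)
    (hθ : θ ∈ Icc (π / 2 - δ) (π / 2 + δ)) :
    (R₁ * cos θ, R₁ * sin θ) ∈ crackSetPlus R₁ δ :=
  ⟨⟨θ, .inl hθ, rfl⟩, mul_pos hR₁ (sin_pos_of_pos_of_lt_pi
    (by linarith [hθ.1, pi_pos]) (by linarith [hθ.2, pi_pos]))⟩

theorem IsRadialFactor.exists_poincare {R κ R₁ : ℝ} {g : ℝ → ℝ} (hg : IsRadialFactor R κ g)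
    (hR₁ : 0 < R₁) (h : R₁ < R) : ∃ C, 0 < C ∧ ∀ δ ∈ Ioo 0 (π / 4), ∀ w : ℝ × ℝ → ℝ,
      ContDiff ℝ (⊤ : ℕ∞) w → tsupport w ⊆ halfDisk R → (∀ x ∈ crackSetPlus R₁ δ, w x = 0) →
      2 * δ * (∫ x, (x.2 * g (x.1 ^ 2 + x.2 ^ 2) * w x) ^ 2) ≤
        C * ∫ x, (x.2 * g (x.1 ^ 2 + x.2 ^ 2)) ^ 2 * gradSq w x := by
  obtain ⟨M, hM0, hM⟩ := hg.exists_weight_bound hR₁ h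
  have hR : 0 < R := hR₁.trans h
  have hpi := pi_pos
  refine ⟨4 * π ^ 3 * R ^ 2 + 4 * π * M * R ^ 2, by positivity, ?_⟩
  rintro δ ⟨hδ0, hδ⟩ w hw hsupp hzero
  have hgc : Continuous g := hg.contDiff.continuous
  have hwd : Differentiable ℝ w := hw.differentiable (by simp)
  have hfc : ∀ v, Continuous fun x => fderiv ℝ w x v := fun v =>
    (contDiff_fderiv_apply hw v).continuous
  have hout : ∀ x ∉ halfDisk R, w x = 0 := fun x hx =>
    image_eq_zero_of_notMem_tsupport fun hx' => hx (hsupp hx')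
  have hout' : ∀ x ∉ halfDisk R, gradSq w x = 0 := fun x hx =>
    gradSq_eq_zero_of_notMem_tsupport fun hx' => hx (hsupp hx')
  have hlin : ∀ x (a b : ℝ), fderiv ℝ w x (a, b) =
      a * fderiv ℝ w x (1, 0) + b * fderiv ℝ w x (0, 1) := by
    intro x a b
    have : ((a, b) : ℝ × ℝ) = a • (1, 0) + b • (0, 1) := by simp
    rw [this, map_add, map_smul, map_smul, smul_eq_mul, smul_eq_mul]
  set P : ℝ → ℝ → ℝ × ℝ := fun r θ => (r * cos θ, r * sin θ) with hP
  set D₁ : ℝ → ℝ → ℝ := fun r θ => fderiv ℝ w (P r θ) (1, 0) with hD₁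
  set D₂ : ℝ → ℝ → ℝ := fun r θ => fderiv ℝ w (P r θ) (0, 1) with hD₂
  have hPc : Continuous (Function.uncurry P) := by
    simp only [hP, Function.uncurry_def]; fun_prop
  have cD₁ : Continuous (Function.uncurry D₁) := (hfc (1, 0)).comp hPc
  have cD₂ : Continuous (Function.uncurry D₂) := (hfc (0, 1)).comp hPc
  set T : ℝ → ℝ → ℝ := fun r θ => -sin θ * D₁ r θ + cos θ * D₂ r θ with hT
  set Wr : ℝ → ℝ → ℝ := fun r θ => cos θ * D₁ r θ + sin θ * D₂ r θ with hWr
  have cc : Continuous (Function.uncurry fun _ θ : ℝ => cos θ) := by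
    simp only [Function.uncurry_def]; fun_prop
  have cs : Continuous (Function.uncurry fun _ θ : ℝ => sin θ) := by
    simp only [Function.uncurry_def]; fun_prop
  have cT : Continuous (Function.uncurry T) := (cs.neg.mul cD₁).add (cc.mul cD₂)
  have cWr : Continuous (Function.uncurry Wr) := (cc.mul cD₁).add (cs.mul cD₂)
  have cWθ : Continuous (Function.uncurry fun r θ => r * T r θ) := continuous_fst.mul cT
  have hgrad : ∀ r θ, gradSq w (P r θ) = Wr r θ ^ 2 + T r θ ^ 2 := by
    intro r θ
    simp only [gradSq, hWr, hT]
    linear_combination (-(D₁ r θ) ^ 2 - (D₂ r θ) ^ 2) * sin_sq_add_cos_sq θ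
  have dr : ∀ r θ, HasDerivAt (fun r => w (P r θ)) (Wr r θ) r := by
    intro r θ
    have h1 : HasDerivAt (fun r => P r θ) (cos θ, sin θ) r := by
      have a := (hasDerivAt_id r).mul_const (cos θ)
      have b := (hasDerivAt_id r).mul_const (sin θ)
      simpa using a.prodMk b
    have := (hwd (P r θ)).hasFDerivAt.comp_hasDerivAt r h1
    rwa [hlin] at this
  have dθ : ∀ r θ, HasDerivAt (fun θ => w (P r θ)) (r * T r θ) θ := by
    intro r θ
    have h1 : HasDerivAt (fun θ => P r θ) (r * -sin θ, r * cos θ) θ :=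
      ((hasDerivAt_cos θ).const_mul r).prodMk ((hasDerivAt_sin θ).const_mul r)
    have := (hwd (P r θ)).hasFDerivAt.comp_hasDerivAt θ h1
    rw [hlin] at this
    refine this.congr_deriv ?_
    simp only [hT, hD₁, hD₂]
    ring
  have hsub : Icc (π / 2 - δ) (π / 2 + δ) ⊆ Icc (π / 4) (3 * π / 4) :=
    Icc_subset_Icc (by linarith) (by linarith)
  have main := weighted_poincare_of_vanish_on_segment (R := R) (ρ := R₁) (α := π / 2 - δ)
    (β := π / 2 + δ) (p := fun r => r ^ 3 * g (r ^ 2) ^ 2) (q := fun θ => sin θ ^ 2)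
    (W := fun r θ => w (P r θ)) ⟨hR₁.le, h.le⟩ (by linarith) (by linarith) (by linarith) hM0
    (by fun_prop) (by fun_prop) (fun r hr => mul_nonneg (pow_nonneg hr.1 3) (sq_nonneg _))
    (fun _ _ => sq_nonneg _) (fun θ _ => sin_sq_le_one θ)
    (fun θ hθ => one_half_le_sin_sq (hsub hθ)) hM
    (fun θ hθ t ht s hs => sin_sq_le_two_mul_sin_sq (hsub hθ) ht hs)
    (hw.continuous.comp hPc) cWr cWθ dr dθ
    (fun θ hθ => hzero _ (polar_mem_crackSetPlus hR₁ hδ hθ))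
  have pol : ∀ r θ, (r * cos θ) ^ 2 + (r * sin θ) ^ 2 = r ^ 2 := fun r θ => by
    linear_combination r ^ 2 * sin_sq_add_cos_sq θ
  have hI : ∫ x : ℝ × ℝ, (x.2 * g (x.1 ^ 2 + x.2 ^ 2) * w x) ^ 2 =
      ∫ r in 0..R, ∫ θ in 0..π, r ^ 3 * g (r ^ 2) ^ 2 * sin θ ^ 2 * w (P r θ) ^ 2 := by
    rw [integral_eq_polar hR.le (by have := hw.continuous; fun_prop)
      (fun x hx => by rw [hout x hx]; ring)]
    refine intervalIntegral.integral_congr fun r _ => intervalIntegral.integral_congr fun θ _ => ?_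
    simp only [pol, hP]
    ring
  have cS : Continuous (Function.uncurry fun r θ => r ^ 3 * g (r ^ 2) ^ 2 * sin θ ^ 2) := by
    simp only [Function.uncurry_def]; fun_prop
  have hE : ∫ x : ℝ × ℝ, (x.2 * g (x.1 ^ 2 + x.2 ^ 2)) ^ 2 * gradSq w x =
      ∫ r in 0..R, ∫ θ in 0..π, r ^ 3 * g (r ^ 2) ^ 2 * sin θ ^ 2 * (Wr r θ ^ 2 + T r θ ^ 2) := by
    rw [integral_eq_polar hR.le (by have := continuous_gradSq hw; fun_prop)
      (fun x hx => by rw [hout' x hx]; ring)]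
    refine intervalIntegral.integral_congr fun r _ => intervalIntegral.integral_congr fun θ _ => ?_
    simp only [pol, ← hgrad, hP]
    ring
  have hpar : ∀ {F : ℝ → ℝ → ℝ}, Continuous (Function.uncurry F) →
      IntervalIntegrable (fun r => ∫ θ in 0..π, F r θ) volume 0 R := fun hF =>
    (intervalIntegral.continuous_parametric_intervalIntegral_of_continuous hF
      continuous_const).intervalIntegrable _ _
  have hslice : ∀ {F : ℝ → ℝ → ℝ}, Continuous (Function.uncurry F) → ∀ r,
      IntervalIntegrable (F r) volume 0 π := fun {F} hF r =>
    (hF.comp (by fun_prop : Continuous fun θ : ℝ => (r, θ))).intervalIntegrable _ _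
  have mono : ∀ {F G : ℝ → ℝ → ℝ}, Continuous (Function.uncurry F) →
      Continuous (Function.uncurry G) → (∀ r ∈ Icc 0 R, ∀ θ, F r θ ≤ G r θ) →
      ∫ r in 0..R, ∫ θ in 0..π, F r θ ≤ ∫ r in 0..R, ∫ θ in 0..π, G r θ :=
    fun hF hG hFG => intervalIntegral.integral_mono_on hR.le (hpar hF) (hpar hG) fun r hr =>
      intervalIntegral.integral_mono_on hpi.le (hslice hF r) (hslice hG r) fun θ _ => hFG r hr θ
  have cE : Continuous (Function.uncurry fun r θ => r ^ 3 * g (r ^ 2) ^ 2 * sin θ ^ 2 *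
      (Wr r θ ^ 2 + T r θ ^ 2)) := cS.mul ((cWr.pow 2).add (cT.pow 2))
  have hw0 : ∀ r ∈ Icc 0 R, ∀ θ, 0 ≤ r ^ 3 * g (r ^ 2) ^ 2 * sin θ ^ 2 := fun r hr θ =>
    mul_nonneg (mul_nonneg (pow_nonneg hr.1 3) (sq_nonneg _)) (sq_nonneg _)
  have hJr := mono (F := fun r θ => r ^ 3 * g (r ^ 2) ^ 2 * sin θ ^ 2 * Wr r θ ^ 2)
    ((cS.mul (cWr.pow 2)).congr fun _ => rfl) cE fun r hr θ =>
    mul_le_mul_of_nonneg_left (le_add_of_nonneg_right (sq_nonneg (T r θ))) (hw0 r hr θ)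
  have hJθ := mono (F := fun r θ => r ^ 3 * g (r ^ 2) ^ 2 * sin θ ^ 2 * (r * T r θ) ^ 2)
    (G := fun r θ => R ^ 2 * (r ^ 3 * g (r ^ 2) ^ 2 * sin θ ^ 2 * (Wr r θ ^ 2 + T r θ ^ 2)))
    ((cS.mul (cWθ.pow 2)).congr fun _ => rfl) (cE.const_mul (R ^ 2)) fun r hr θ => by
    have h1 : r ^ 2 * T r θ ^ 2 ≤ R ^ 2 * (Wr r θ ^ 2 + T r θ ^ 2) :=
      mul_le_mul (pow_le_pow_left₀ hr.1 hr.2 2) (le_add_of_nonneg_left (sq_nonneg _))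
        (sq_nonneg _) (sq_nonneg _)
    calc r ^ 3 * g (r ^ 2) ^ 2 * sin θ ^ 2 * (r * T r θ) ^ 2
        = r ^ 3 * g (r ^ 2) ^ 2 * sin θ ^ 2 * (r ^ 2 * T r θ ^ 2) := by ring
      _ ≤ r ^ 3 * g (r ^ 2) ^ 2 * sin θ ^ 2 * (R ^ 2 * (Wr r θ ^ 2 + T r θ ^ 2)) :=
        mul_le_mul_of_nonneg_left h1 (hw0 r hr θ)
      _ = _ := by ring
  simp only [intervalIntegral.integral_const_mul] at hJθ
  rw [← hE] at hJr hJθ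
  rw [← hI] at main
  have e : π / 2 + δ - (π / 2 - δ) = 2 * δ := by ring
  rw [e] at main
  refine main.trans ?_
  have k1 := mul_le_mul_of_nonneg_left hJθ (by positivity : 0 ≤ 4 * π ^ 3)
  have k2 := mul_le_mul_of_nonneg_left hJr (by positivity : 0 ≤ 4 * π * M * R ^ 2)
  linarith

theorem exists_testFun_ne_zero {ω : Set (ℝ × ℝ)} (hω : (interior ω).Nonempty) :
    ∃ u, testFun ω u ∧ u ≠ 0 := by
  obtain ⟨x, hx⟩ := hω
  obtain ⟨u, h1, h2, h3, -, h4⟩ :=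
    exists_contDiff_tsupport_subset (n := (⊤ : ℕ∞)) (mem_interior_iff_mem_nhds.1 hx)
  refine ⟨u, ⟨h3, h2, h1⟩, fun h => ?_⟩
  simp [h] at h4

theorem interior_halfDisk_sdiff_crackSetPlus_nonempty {R₁ R₂ : ℝ} (hR₁ : 0 < R₁) (h : R₁ < R₂)
    (δ : ℝ) : (interior (halfDisk R₂ \ crackSetPlus R₁ δ)).Nonempty := by
  have ho : IsOpen (halfDisk R₁) := by
    refine IsOpen.inter (isOpen_lt (by fun_prop) (by fun_prop)) (isOpen_lt (by fun_prop) (by fun_prop))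
  have hs : halfDisk R₁ ⊆ halfDisk R₂ \ crackSetPlus R₁ δ := by
    rintro x ⟨hx1, hx2⟩
    have hx1' : x.1 ^ 2 + x.2 ^ 2 < R₁ ^ 2 := hx1
    refine ⟨⟨hx1'.trans (pow_lt_pow_left₀ h hR₁.le two_ne_zero), hx2⟩, ?_⟩
    rintro ⟨⟨θ, -, rfl⟩, -⟩
    nlinarith [sin_sq_add_cos_sq θ]
  refine ⟨(0, R₁ / 2), interior_maximal hs ho ⟨?_, ?_⟩⟩
  · change (0 : ℝ) ^ 2 + (R₁ / 2) ^ 2 < R₁ ^ 2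
    nlinarith
  · change 0 < R₁ / 2
    linarith

theorem IsRadialFactor.exists_le_dirichletEV_one {R₁ R₂ κ : ℝ} {g : ℝ → ℝ}
    (hg : IsRadialFactor R₂ κ g) (hR₁ : 0 < R₁) (h : R₁ < R₂) :
    ∃ c, 0 < c ∧ ∀ δ ∈ Ioo 0 (π / 4),
      4 * κ + c * δ ≤ dirichletEV (halfDisk R₂ \ crackSetPlus R₁ δ) 1 := by
  obtain ⟨C, hC, hP⟩ := hg.exists_poincare hR₁ h
  refine ⟨2 / C, by positivity, fun δ hδ => le_dirichletEV_one (exists_testFun_ne_zero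
    (interior_halfDisk_sdiff_crackSetPlus_nonempty hR₁ h δ)) fun u hu hu0 => ?_⟩
  set φ : ℝ × ℝ → ℝ := fun x => x.2 * g (x.1 ^ 2 + x.2 ^ 2) with hφ
  have hφs : ContDiff ℝ (⊤ : ℕ∞) φ := contDiff_snd.mul (contDiff_comp_normSq hg.contDiff)
  have hφ0 : ∀ x ∈ tsupport u, φ x ≠ 0 := by
    intro x hx
    obtain ⟨⟨h1, h2⟩, -⟩ := hu.2.2 hx
    exact (mul_pos h2 (hg.pos _ ⟨by positivity, h1⟩)).ne'
  obtain ⟨w, hw, huw, hw0⟩ := exists_eq_mul_of_ne_zero hu.1 hφs hφ0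
  have hts : tsupport w ⊆ tsupport u := closure_mono fun x hx hx' => hx (hw0 x hx')
  have hwc : HasCompactSupport w := hu.2.1.mono' fun x hx => hts (subset_tsupport _ hx)
  have huw' : u = fun x => φ x * w x := funext huw
  have hid := integral_gradSq_mul (l := 4 * κ) hφs
    (laplacian_snd_mul hg.contDiff hg.ode) hw hwc
  have hp := hP δ hδ w hw (fun x hx => (hu.2.2 (hts hx)).1) fun x hx =>
    image_eq_zero_of_notMem_tsupport fun hx' => (hu.2.2 (hts hx')).2 hx
  have hpos : 0 < ∫ x, u x ^ 2 := integral_sq_pos hu.1.continuous hu.2.1 hu0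
  rw [rayleigh_eq hu, le_div_iff₀ hpos]
  rw [huw', hid]
  simp only [hφ] at hp ⊢
  have : 2 / C * δ * (∫ x : ℝ × ℝ, (x.2 * g (x.1 ^ 2 + x.2 ^ 2) * w x) ^ 2) ≤
      ∫ x : ℝ × ℝ, (x.2 * g (x.1 ^ 2 + x.2 ^ 2)) ^ 2 * gradSq w x := by
    rw [div_mul_eq_mul_div, div_mul_eq_mul_div, div_le_iff₀ hC]
    linarith
  linarith

theorem exists_cutoff : ∃ (h : ℝ → ℝ) (H : ℝ), 0 ≤ H ∧ ContDiff ℝ (⊤ : ℕ∞) h ∧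
    (∀ s, h s ∈ Icc 0 1) ∧ (∀ s < 1, h s = 0) ∧ (∀ s, 2 ≤ s → h s = 1) ∧
    (∀ s, deriv h s ^ 2 ≤ H) ∧ ∀ s ∉ Icc (1 : ℝ) 2, deriv h s = 0 := by
  have hs : ContDiff ℝ (⊤ : ℕ∞) fun s : ℝ => smoothTransition (s - 1) :=
    smoothTransition.contDiff.comp (contDiff_id.sub contDiff_const)
  have hz : ∀ s < 1, smoothTransition (s - 1) = 0 := fun s hs =>
    smoothTransition.zero_of_nonpos (by linarith)
  have ho : ∀ s, 2 ≤ s → smoothTransition (s - 1) = 1 := fun s hs =>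
    smoothTransition.one_of_one_le (by linarith)
  have hout : ∀ s ∉ Icc (1 : ℝ) 2, deriv (fun s => smoothTransition (s - 1)) s = 0 := by
    intro s hs'
    rcases lt_or_ge s 1 with h1 | h1
    · have : (fun s => smoothTransition (s - 1)) =ᶠ[nhds s] fun _ => 0 := by
        filter_upwards [Iio_mem_nhds h1] with t ht using hz t ht
      simp [this.deriv_eq]
    · have h2 : 2 < s := by
        by_contra! h2
        exact hs' ⟨h1, h2⟩
      have : (fun s => smoothTransition (s - 1)) =ᶠ[nhds s] fun _ => 1 := by
        filter_upwards [Ioi_mem_nhds h2] with t ht using ho t (le_of_lt ht)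
      simp [this.deriv_eq]
  obtain ⟨H, hH⟩ := isCompact_Icc.exists_bound_of_continuousOn (s := Icc (1 : ℝ) 2)
    ((hs.continuous_deriv (by simp)).pow 2).continuousOn
  have hH0 : 0 ≤ H := (norm_nonneg _).trans (hH 1 (by norm_num))
  refine ⟨_, H, hH0, hs, fun s => ⟨smoothTransition.nonneg _, smoothTransition.le_one _⟩, hz, ho,
    fun s => ?_, hout⟩
  by_cases hs' : s ∈ Icc (1 : ℝ) 2
  · exact (le_norm_self _).trans (hH s hs')
  · rw [hout s hs']
    simpa using hH0

theorem gradSq_comp_div {h : ℝ → ℝ} {f : ℝ × ℝ → ℝ} (hh : Differentiable ℝ h)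
    (hf : Differentiable ℝ f) (η : ℝ) (x : ℝ × ℝ) :
    gradSq (fun x => h (f x / η)) x = deriv h (f x / η) ^ 2 / η ^ 2 * gradSq f x := by
  have h1 : HasFDerivAt (fun x => f x / η) (η⁻¹ • fderiv ℝ f x) x := by
    simpa only [div_eq_mul_inv] using (hf x).hasFDerivAt.mul_const η⁻¹
  have h2 := ((hh (f x / η)).hasDerivAt.comp_hasFDerivAt x h1).fderiv
  simp only [Function.comp_def] at h2
  simp only [gradSq, h2, smul_apply, smul_eq_mul]
  ring

theorem gradSq_mul_mul_le {a b c : ℝ × ℝ → ℝ} (ha : Differentiable ℝ a) (hb : Differentiable ℝ b)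
    (hc : Differentiable ℝ c) (x : ℝ × ℝ) (ha1 : a x ∈ Icc 0 1) (hb1 : b x ∈ Icc 0 1)
    (hc1 : c x ∈ Icc 0 1) :
    gradSq (fun x => a x * b x * c x) x ≤ 3 * (gradSq a x + gradSq b x + gradSq c x) := by
  have key : ∀ p q r d : ℝ, p ∈ Icc 0 1 → q ∈ Icc 0 1 → r = p * q → (r * d) ^ 2 ≤ d ^ 2 := by
    rintro p q r d hp hq rfl
    have h0 : 0 ≤ p * q := mul_nonneg hp.1 hq.1
    have h1 : p * q ≤ 1 := mul_le_one₀ hp.2 hq.1 hq.2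
    rw [mul_pow]
    exact mul_le_of_le_one_left (sq_nonneg _) (pow_le_one₀ h0 h1)
  have h1 := (((ha x).hasFDerivAt.mul (hb x).hasFDerivAt).mul (hc x).hasFDerivAt).fderiv
  have h2 : ∀ v, fderiv ℝ (fun x => a x * b x * c x) x v = (b x * c x) * fderiv ℝ a x v +
      (a x * c x) * fderiv ℝ b x v + (a x * b x) * fderiv ℝ c x v := by
    intro v
    have : fderiv ℝ (fun x => a x * b x * c x) x = _ := h1
    rw [this]
    simp only [add_apply, smul_apply, smul_eq_mul,
      Pi.mul_apply]
    ring
  have h3 : ∀ v, fderiv ℝ (fun x => a x * b x * c x) x v ^ 2 ≤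
      3 * (fderiv ℝ a x v ^ 2 + fderiv ℝ b x v ^ 2 + fderiv ℝ c x v ^ 2) := by
    intro v
    rw [h2]
    have k1 := key _ _ _ (fderiv ℝ a x v) hb1 hc1 rfl
    have k2 := key _ _ _ (fderiv ℝ b x v) ha1 hc1 rfl
    have k3 := key _ _ _ (fderiv ℝ c x v) ha1 hb1 rfl
    generalize (b x * c x) * fderiv ℝ a x v = A at *
    generalize (a x * c x) * fderiv ℝ b x v = B at *
    generalize (a x * b x) * fderiv ℝ c x v = C at *
    nlinarith [sq_nonneg (A - B), sq_nonneg (A - C), sq_nonneg (B - C)]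
  have := h3 (1, 0)
  have := h3 (0, 1)
  unfold gradSq at *
  linarith

theorem gradSq_fst (x : ℝ × ℝ) : gradSq (fun x => x.1) x = 1 := by
  rw [gradSq, fderiv_fst_eq differentiableAt_fst (hasDerivAt_id _),
    fderiv_snd_eq differentiableAt_fst (hasDerivAt_const _ _)]
  norm_num

theorem gradSq_const_sub_normSq (c : ℝ) (x : ℝ × ℝ) :
    gradSq (fun x => c - (x.1 ^ 2 + x.2 ^ 2)) x = 4 * (x.1 ^ 2 + x.2 ^ 2) := by
  have hd : DifferentiableAt ℝ (fun x : ℝ × ℝ => c - (x.1 ^ 2 + x.2 ^ 2)) x := by fun_prop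
  have h1 : HasDerivAt (fun t : ℝ => c - (t ^ 2 + x.2 ^ 2)) (-(2 * x.1)) x.1 := by
    simpa using ((hasDerivAt_pow 2 x.1).add_const (x.2 ^ 2)).const_sub c
  have h2 : HasDerivAt (fun t : ℝ => c - (x.1 ^ 2 + t ^ 2)) (-(2 * x.2)) x.2 := by
    simpa using ((hasDerivAt_pow 2 x.2).const_add (x.1 ^ 2)).const_sub c
  rw [gradSq, fderiv_fst_eq hd h1, fderiv_snd_eq hd h2]
  ring

theorem gradSq_sq_add_sq_le (c : ℝ) (x : ℝ × ℝ) :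
    gradSq (fun x => x.1 ^ 2 + (x.1 ^ 2 + x.2 ^ 2 - c) ^ 2) x ≤
      (8 + 32 * (x.1 ^ 2 + x.2 ^ 2)) * (x.1 ^ 2 + (x.1 ^ 2 + x.2 ^ 2 - c) ^ 2) := by
  have hd : DifferentiableAt ℝ (fun x : ℝ × ℝ => x.1 ^ 2 + (x.1 ^ 2 + x.2 ^ 2 - c) ^ 2) x := by
    fun_prop
  have h1 : HasDerivAt (fun t : ℝ => t ^ 2 + (t ^ 2 + x.2 ^ 2 - c) ^ 2)
      (2 * x.1 + 2 * (x.1 ^ 2 + x.2 ^ 2 - c) * (2 * x.1)) x.1 := by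
    simpa using (hasDerivAt_pow 2 x.1).fun_add
      (((hasDerivAt_pow 2 x.1).add_const (x.2 ^ 2)).sub_const c |>.fun_pow 2)
  have h2 : HasDerivAt (fun t : ℝ => x.1 ^ 2 + (x.1 ^ 2 + t ^ 2 - c) ^ 2)
      (2 * (x.1 ^ 2 + x.2 ^ 2 - c) * (2 * x.2)) x.2 := by
    simpa using ((((hasDerivAt_pow 2 x.2).const_add (x.1 ^ 2)).sub_const c).fun_pow 2).const_add
      (x.1 ^ 2)
  rw [gradSq, fderiv_fst_eq hd h1, fderiv_snd_eq hd h2]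
  generalize x.1 ^ 2 + x.2 ^ 2 - c = S
  nlinarith [sq_nonneg (x.1 - 2 * (x.1 * S)), sq_nonneg (x.2 * S), sq_nonneg (x.1 * x.2),
    sq_nonneg (x.1 * x.1), sq_nonneg S]

theorem isOpen_disk (R : ℝ) : IsOpen (disk R) := isOpen_lt (by fun_prop) (by fun_prop)

theorem disk_subset_prod {R : ℝ} (hR : 0 ≤ R) : disk R ⊆ Icc (-R) R ×ˢ Icc (-R) R := by
  intro x hx
  have hx : x.1 ^ 2 + x.2 ^ 2 < R ^ 2 := hx
  exact ⟨abs_le.1 (abs_le_of_sq_le_sq (by nlinarith) hR),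
    abs_le.1 (abs_le_of_sq_le_sq (by nlinarith) hR)⟩

theorem volume_disk_ne_top (R : ℝ) : volume (disk R) ≠ ⊤ := by
  have : disk R = disk |R| := by simp [disk]
  rw [this]
  exact measure_ne_top_of_subset (disk_subset_prod (abs_nonneg R))
    (isCompact_Icc.prod isCompact_Icc).measure_ne_top

open scoped Pointwise in
theorem volume_real_disk {R : ℝ} (hR : 0 < R) :
    volume.real (disk R) = R ^ 2 * volume.real (disk 1) := by
  have h : disk R = R • disk 1 := by
    ext x
    rw [mem_smul_set_iff_inv_smul_mem₀ hR.ne']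
    simp only [disk, mem_ofPred_eq, Prod.smul_fst, Prod.smul_snd, smul_eq_mul]
    rw [← mul_lt_mul_iff_right₀ (sq_pos_of_pos hR)]
    field_simp
  rw [h, measureReal_def, Measure.addHaar_smul, ENNReal.toReal_mul, ENNReal.toReal_ofReal
    (abs_nonneg _), Module.finrank_prod, Module.finrank_self, abs_of_nonneg (by positivity),
    measureReal_def]

theorem volume_real_prod_Icc {a b c d : ℝ} (hab : a ≤ b) (hcd : c ≤ d) :
    volume.real (Icc a b ×ˢ Icc c d) = (b - a) * (d - c) := by
  rw [Measure.volume_eq_prod, measureReal_prod_prod, Real.volume_real_Icc_of_le hab,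
    Real.volume_real_Icc_of_le hcd]

theorem volume_real_shell_le {R η : ℝ} (hη : 0 < η) (h : 2 * η < R ^ 2) :
    volume.real {x : ℝ × ℝ | R ^ 2 - (x.1 ^ 2 + x.2 ^ 2) ∈ Icc η (2 * η)} ≤
      2 * volume.real (disk 1) * η := by
  have h1 : 0 < √(R ^ 2 - 2 * η) := sqrt_pos.2 (by linarith)
  have h2 : 0 < √(R ^ 2 - η / 2) := sqrt_pos.2 (by linarith)
  have s1 : √(R ^ 2 - 2 * η) ^ 2 = R ^ 2 - 2 * η := sq_sqrt (by linarith)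
  have s2 : √(R ^ 2 - η / 2) ^ 2 = R ^ 2 - η / 2 := sq_sqrt (by linarith)
  have hsub : {x : ℝ × ℝ | R ^ 2 - (x.1 ^ 2 + x.2 ^ 2) ∈ Icc η (2 * η)} ⊆
      disk √(R ^ 2 - η / 2) \ disk √(R ^ 2 - 2 * η) := by
    rintro x ⟨hx1, hx2⟩
    simp only [disk, mem_sdiff, mem_ofPred_eq, s1, s2, not_lt]
    constructor <;> linarith
  have hss : disk √(R ^ 2 - 2 * η) ⊆ disk √(R ^ 2 - η / 2) := by
    intro x hx
    simp only [disk, mem_ofPred_eq, s1, s2] at hx ⊢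
    linarith
  refine (measureReal_mono hsub (measure_ne_top_of_subset sdiff_subset
    (volume_disk_ne_top _))).trans ?_
  rw [measureReal_sdiff hss (isOpen_disk _).measurableSet (volume_disk_ne_top _),
    volume_real_disk h1, volume_real_disk h2, s1, s2]
  have : 0 ≤ volume.real (disk 1) := measureReal_nonneg
  nlinarith

theorem gradSq_cutoff_eq_zero {h : ℝ → ℝ} {f : ℝ × ℝ → ℝ} {η : ℝ} (hh : Differentiable ℝ h)
    (hf : Differentiable ℝ f) (hη : 0 < η) (hout : ∀ s ∉ Icc (1 : ℝ) 2, deriv h s = 0) {x : ℝ × ℝ}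
    (hx : f x ∉ Icc η (2 * η)) : gradSq (fun x => h (f x / η)) x = 0 := by
  rw [gradSq_comp_div hh hf, hout]
  · simp
  · rintro ⟨h1, h2⟩
    exact hx ⟨(one_le_div₀ hη).1 h1, (div_le_iff₀ hη).1 h2⟩

theorem mul_gradSq_cutoff_le {h : ℝ → ℝ} {f : ℝ × ℝ → ℝ} {η H A K : ℝ} (hh : Differentiable ℝ h)
    (hf : Differentiable ℝ f) (hη : 0 < η) (hout : ∀ s ∉ Icc (1 : ℝ) 2, deriv h s = 0)
    (hH : ∀ s, deriv h s ^ 2 ≤ H) (hA : 0 ≤ A) (hK : 0 ≤ K) (x : ℝ × ℝ)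
    (hx : f x ∈ Icc η (2 * η) → A * gradSq f x ≤ K * η ^ 2) :
    A * gradSq (fun x => h (f x / η)) x ≤ H * K := by
  have hH0 : 0 ≤ H := (sq_nonneg _).trans (hH 0)
  by_cases hfx : f x ∈ Icc η (2 * η)
  · rw [gradSq_comp_div hh hf]
    have h0 : 0 ≤ A * gradSq f x := mul_nonneg hA (gradSq_nonneg _ _)
    calc A * (deriv h (f x / η) ^ 2 / η ^ 2 * gradSq f x)
        = deriv h (f x / η) ^ 2 * (A * gradSq f x / η ^ 2) := by ring
      _ ≤ H * K := mul_le_mul (hH _) ((div_le_iff₀ (by positivity)).2 (hx hfx))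
          (by positivity) hH0
  · rw [gradSq_cutoff_eq_zero hh hf hη hout hfx, mul_zero]
    positivity

theorem IsRadialFactor.exists_le_mul_sub {R κ : ℝ} {g : ℝ → ℝ} (hg : IsRadialFactor R κ g) :
    ∃ L, 0 ≤ L ∧ ∀ s ∈ Icc 0 (R ^ 2), g s ≤ L * (R ^ 2 - s) := by
  have h0R : (0 : ℝ) ≤ R ^ 2 := sq_nonneg R
  obtain ⟨L, hL⟩ := isCompact_Icc.exists_bound_of_continuousOn (s := Icc 0 (R ^ 2))
    (hg.contDiff.continuous_deriv (by simp)).continuousOn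
  refine ⟨L, (norm_nonneg _).trans (hL 0 ⟨le_rfl, h0R⟩), fun s hs => ?_⟩
  have := Convex.norm_image_sub_le_of_norm_deriv_le (𝕜 := ℝ) (f := g)
    (fun x _ => hg.contDiff.differentiable (by simp) x) hL (convex_Icc _ _)
    (right_mem_Icc.2 h0R) hs
  rw [hg.zero, sub_zero, norm_eq_abs, norm_eq_abs, abs_sub_comm, abs_of_nonneg
    (sub_nonneg.2 hs.2)] at this
  exact (le_abs_self _).trans this

theorem crackSet_fst_sq_le {R₁ δ : ℝ} {x : ℝ × ℝ} (hx : x ∈ crackSet R₁ δ) :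
    x.1 ^ 2 + x.2 ^ 2 = R₁ ^ 2 ∧ x.1 ^ 2 ≤ R₁ ^ 2 * δ ^ 2 := by
  obtain ⟨θ, hθ, rfl⟩ := hx
  refine ⟨by linear_combination R₁ ^ 2 * sin_sq_add_cos_sq θ, ?_⟩
  have key : ∀ t, t ∈ Icc (-δ) δ → sin t ^ 2 ≤ δ ^ 2 := fun t ht =>
    sq_le_sq' (by linarith [neg_abs_le (sin t), abs_sin_le_abs (x := t), abs_le.2 ht])
      (by linarith [le_abs_self (sin t), abs_sin_le_abs (x := t), abs_le.2 ht])
  have hc : cos θ ^ 2 ≤ δ ^ 2 := by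
    rcases hθ with hθ | hθ
    · rw [← sin_pi_div_two_sub]
      exact key _ ⟨by linarith [hθ.2], by linarith [hθ.1]⟩
    · rw [← sin_add_pi_div_two]
      exact key _ ⟨by linarith [hθ.1], by linarith [hθ.2]⟩
  rw [mul_pow]
  gcongr

theorem reflectFst_preimage_disk_sdiff_crackSet (R₁ R₂ δ : ℝ) :
    reflectFst ⁻¹' (disk R₂ \ crackSet R₁ δ) = disk R₂ \ crackSet R₁ δ := by
  have key : ∀ x, x ∈ crackSet R₁ δ → reflectFst x ∈ crackSet R₁ δ := by
    rintro _ ⟨θ, hθ, rfl⟩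
    rcases hθ with hθ | hθ
    · refine ⟨π - θ, .inl ⟨by linarith [hθ.2], by linarith [hθ.1]⟩, ?_⟩
      rw [reflectFst_apply, cos_pi_sub, sin_pi_sub, mul_neg]
    · refine ⟨-π - θ, .inr ⟨by linarith [hθ.2], by linarith [hθ.1]⟩, ?_⟩
      have e : -π - θ = -(θ + π) := by ring
      rw [reflectFst_apply, e, cos_neg, sin_neg, cos_add_pi, sin_add_pi, mul_neg, neg_neg]
  have hinv : ∀ x, reflectFst (reflectFst x) = x := fun x => by simp [reflectFst_apply]
  have hiff : ∀ x, reflectFst x ∈ crackSet R₁ δ ↔ x ∈ crackSet R₁ δ := fun x =>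
    ⟨fun h => hinv x ▸ key _ h, key x⟩
  ext x
  rw [mem_preimage, mem_sdiff, mem_sdiff, hiff]
  simp only [disk, mem_ofPred_eq, reflectFst_apply, neg_sq]

/-- The defining function of a neighbourhood basis of `(0, ±R₁)` used to cut off near the crack. -/
def crackGauge (R₁ : ℝ) (x : ℝ × ℝ) : ℝ := x.1 ^ 2 + (x.1 ^ 2 + x.2 ^ 2 - R₁ ^ 2) ^ 2

theorem crackGauge_mem {R₁ δ : ℝ} (hR₁ : 0 < R₁) (hδ : 0 < δ) (hδ1 : δ ≤ 1) {x : ℝ × ℝ}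
    (hx : crackGauge R₁ x ≤ 8 * R₁ ^ 2 * δ ^ 2) :
    x ∈ Icc (-(3 * R₁ * δ)) (3 * R₁ * δ) ×ˢ
        Icc (R₁ - (3 + 9 * R₁) * δ) (R₁ + (3 + 9 * R₁) * δ) ∪
      Icc (-(3 * R₁ * δ)) (3 * R₁ * δ) ×ˢ
        Icc (-R₁ - (3 + 9 * R₁) * δ) (-R₁ + (3 + 9 * R₁) * δ) := by
  unfold crackGauge at hx
  have hRδ : 0 < R₁ * δ := by positivity
  have h1 : |x.1| ≤ 3 * R₁ * δ :=
    abs_le_of_sq_le_sq (by nlinarith [sq_nonneg (x.1 ^ 2 + x.2 ^ 2 - R₁ ^ 2)]) (by positivity)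
  have h2 : |x.1 ^ 2 + x.2 ^ 2 - R₁ ^ 2| ≤ 3 * R₁ * δ :=
    abs_le_of_sq_le_sq (by nlinarith [sq_nonneg x.1]) (by positivity)
  have h1' := abs_le.1 h1
  have h2' := abs_le.1 h2
  have h3 : x.1 ^ 2 ≤ 9 * R₁ ^ 2 * δ := by
    have : x.1 ^ 2 ≤ 9 * (R₁ * δ) ^ 2 := by nlinarith
    have : (R₁ * δ) ^ 2 ≤ R₁ ^ 2 * δ := by
      rw [mul_pow]
      gcongr
      nlinarith
    linarith
  have hy0 := abs_nonneg x.2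
  have hy := sq_abs x.2
  have h4 : |x.2| ≤ R₁ + (3 + 9 * R₁) * δ := by
    by_contra! hc
    have : (R₁ + (3 + 9 * R₁) * δ) ^ 2 < |x.2| ^ 2 := pow_lt_pow_left₀ hc (by positivity) two_ne_zero
    nlinarith [sq_nonneg x.1, sq_nonneg ((3 + 9 * R₁) * δ), mul_pos hR₁ hRδ]
  have h5 : R₁ - (3 + 9 * R₁) * δ ≤ |x.2| := by
    by_contra! hc
    have : |x.2| ^ 2 ≤ R₁ * |x.2| := by
      rw [pow_two]
      exact mul_le_mul_of_nonneg_right (by nlinarith) hy0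
    nlinarith
  rcases le_total 0 x.2 with h | h
  · rw [abs_of_nonneg h] at h4 h5
    exact .inl ⟨h1', h5, h4⟩
  · rw [abs_of_nonpos h] at h4 h5
    exact .inr ⟨h1', by linarith, by linarith⟩

theorem integral_le_of_le_const {F : ℝ × ℝ → ℝ} {S : Set (ℝ × ℝ)} {K : ℝ} (hS : volume S ≠ ⊤)
    (h0 : ∀ x ∉ S, F x = 0) (hF : ∀ x, 0 ≤ F x) (hK : ∀ x, F x ≤ K) :
    ∫ x, F x ≤ K * volume.real S := by
  rw [← setIntegral_eq_integral_of_forall_compl_eq_zero h0]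
  refine (le_norm_self _).trans (norm_setIntegral_le_of_norm_le_const hS.lt_top fun x _ => ?_)
  rw [norm_of_nonneg (hF x)]
  exact hK x

theorem volume_cutoff_layers_le {R R₁ δ : ℝ} (hR : 0 < R) (hR₁ : 0 < R₁) (hδ : 0 < δ)
    (hδR : 2 * δ ^ 2 < R ^ 2) {S : Set (ℝ × ℝ)}
    (hS : S = Icc (δ ^ 2) (2 * δ ^ 2) ×ˢ Icc (-R) R ∪
      {x : ℝ × ℝ | R ^ 2 - (x.1 ^ 2 + x.2 ^ 2) ∈ Icc (δ ^ 2) (2 * δ ^ 2)} ∪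
      (Icc (-(3 * R₁ * δ)) (3 * R₁ * δ) ×ˢ
        Icc (R₁ - (3 + 9 * R₁) * δ) (R₁ + (3 + 9 * R₁) * δ) ∪
      Icc (-(3 * R₁ * δ)) (3 * R₁ * δ) ×ˢ
        Icc (-R₁ - (3 + 9 * R₁) * δ) (-R₁ + (3 + 9 * R₁) * δ))) :
    volume S ≠ ⊤ ∧ volume.real S ≤
      (2 * R + 2 * volume.real (disk 1) + 24 * R₁ * (3 + 9 * R₁)) * δ ^ 2 := by
  have fin : ∀ a b c d : ℝ, volume (Icc a b ×ˢ Icc c d) ≠ ⊤ := fun a b c d =>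
    (isCompact_Icc.prod isCompact_Icc).measure_ne_top
  have hη : 0 < δ ^ 2 := by positivity
  have hsh : {x : ℝ × ℝ | R ^ 2 - (x.1 ^ 2 + x.2 ^ 2) ∈ Icc (δ ^ 2) (2 * δ ^ 2)} ⊆ disk R := by
    rintro x ⟨hx, -⟩
    change x.1 ^ 2 + x.2 ^ 2 < R ^ 2
    linarith
  constructor
  · rw [hS]
    exact measure_union_ne_top (measure_union_ne_top (fin _ _ _ _)
      (measure_ne_top_of_subset hsh (volume_disk_ne_top _)))
      (measure_union_ne_top (fin _ _ _ _) (fin _ _ _ _))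
  · rw [hS]
    have hb : 0 ≤ (3 + 9 * R₁) * δ := by positivity
    have ha : 0 ≤ 3 * R₁ * δ := by positivity
    refine (measureReal_union_le _ _).trans ((add_le_add (measureReal_union_le _ _)
      (measureReal_union_le _ _)).trans ?_)
    rw [volume_real_prod_Icc (by linarith) (by linarith),
      volume_real_prod_Icc (by linarith) (by linarith),
      volume_real_prod_Icc (by linarith) (by linarith)]
    have := volume_real_shell_le hη hδR
    nlinarith

theorem cutoffs_plateau {R R₁ δ : ℝ} (hR₁ : 0 < R₁) (hR₁R : R₁ < R) (hδ : 0 < δ)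
    (hδ12 : δ < 1 / 12) (hδR : δ < R) (hδR2 : δ < R ^ 2) {x : ℝ × ℝ}
    (hx : x ∈ Icc (R / 4) (R / 2) ×ˢ Icc 0 (R / 4)) :
    2 * δ ^ 2 ≤ x.1 ∧ 2 * δ ^ 2 ≤ R ^ 2 - (x.1 ^ 2 + x.2 ^ 2) ∧
      2 * (4 * R₁ ^ 2 * δ ^ 2) ≤ crackGauge R₁ x ∧ x.1 ^ 2 + x.2 ^ 2 ≤ R ^ 2 / 2 ∧
      x.1 ^ 2 + x.2 ^ 2 ≤ R ^ 2 := by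
  obtain ⟨⟨h1, h2⟩, h3, h4⟩ := hx
  have hR : 0 < R := hR₁.trans hR₁R
  have hηδ : δ ^ 2 ≤ δ / 12 := by nlinarith
  have hx1 : x.1 ^ 2 ≤ (R / 2) ^ 2 := pow_le_pow_left₀ (by linarith) h2 2
  have hx2 : x.2 ^ 2 ≤ (R / 4) ^ 2 := pow_le_pow_left₀ h3 h4 2
  have hx3 : (R / 4) ^ 2 ≤ x.1 ^ 2 := pow_le_pow_left₀ (by linarith) h1 2
  have hR2 : 0 ≤ R ^ 2 := sq_nonneg R
  ring_nf at hx1 hx2 hx3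
  refine ⟨by linarith, by linarith, ?_, by linarith, by linarith⟩
  have k1 : R₁ ^ 2 ≤ R ^ 2 := pow_le_pow_left₀ hR₁.le hR₁R.le 2
  have k2 : δ ^ 2 ≤ 1 / 144 := by linarith
  have k3 : R₁ ^ 2 * δ ^ 2 ≤ R ^ 2 * (1 / 144) := mul_le_mul k1 k2 (sq_nonneg _) hR2
  have k4 := sq_nonneg (x.1 ^ 2 + x.2 ^ 2 - R₁ ^ 2)
  unfold crackGauge
  linarith

set_option maxHeartbeats 1000000 in
theorem IsRadialFactor.exists_dirichletEV_two_le {R₁ R κ : ℝ} {g : ℝ → ℝ}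
    (hg : IsRadialFactor R κ g) (hR₁ : 0 < R₁) (hR₁R : R₁ < R) :
    ∃ C δ₁, 0 < δ₁ ∧ 0 ≤ C ∧ ∀ δ ∈ Ioo 0 δ₁,
      dirichletEV (disk R \ crackSet R₁ δ) 2 ≤ 4 * κ + C * δ ^ 2 := by
  have hR : 0 < R := hR₁.trans hR₁R
  obtain ⟨h, H, hH0, hhs, hh01, hh0, hh1, hH, hhout⟩ := exists_cutoff
  obtain ⟨L, hL0, hL⟩ := hg.exists_le_mul_sub
  have hhd : Differentiable ℝ h := hhs.differentiable (by simp)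
  set K := 3 * (H * (4 * g 0 ^ 2) + H * (16 * R ^ 4 * L ^ 2) +
    H * (4 * g 0 ^ 2 * (8 + 32 * R ^ 2))) with hK
  have hK0 : 0 ≤ K := by positivity
  set V := 2 * R + 2 * volume.real (disk 1) + 24 * R₁ * (3 + 9 * R₁) with hV
  have hV0 : 0 ≤ V := by positivity
  set m := (R / 4 * g (R ^ 2 / 2)) ^ 2 * (R / 4 * (R / 4)) with hm
  have hgm : 0 < g (R ^ 2 / 2) := hg.pos _ ⟨by positivity, by nlinarith⟩
  have hm0 : 0 < m := by positivity
  refine ⟨K * V / m, min (1 / 12) (min R (R ^ 2)), by positivity, by positivity, ?_⟩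
  rintro δ ⟨hδ0, hδ⟩
  obtain ⟨hδa, hδ'⟩ := lt_min_iff.1 hδ
  obtain ⟨hδR, hδR2⟩ := lt_min_iff.1 hδ'
  have hη : 0 < δ ^ 2 := by positivity
  have hη₃ : 0 < 4 * R₁ ^ 2 * δ ^ 2 := by positivity
  have hηδ : δ ^ 2 ≤ δ / 12 := by nlinarith
  set φ : ℝ × ℝ → ℝ := fun x => x.1 * g (x.1 ^ 2 + x.2 ^ 2) with hφ
  set a : ℝ × ℝ → ℝ := fun x => h (x.1 / δ ^ 2) with ha
  set b : ℝ × ℝ → ℝ := fun x => h ((R ^ 2 - (x.1 ^ 2 + x.2 ^ 2)) / δ ^ 2) with hb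
  set c : ℝ × ℝ → ℝ := fun x => h (crackGauge R₁ x / (4 * R₁ ^ 2 * δ ^ 2)) with hc
  set w : ℝ × ℝ → ℝ := fun x => a x * b x * c x with hw
  have hφs : ContDiff ℝ (⊤ : ℕ∞) φ := contDiff_fst.mul (contDiff_comp_normSq hg.contDiff)
  have hf₂ : ContDiff ℝ (⊤ : ℕ∞) fun x : ℝ × ℝ => R ^ 2 - (x.1 ^ 2 + x.2 ^ 2) := by fun_prop
  have hf₃ : ContDiff ℝ (⊤ : ℕ∞) (crackGauge R₁) := by unfold crackGauge; fun_prop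
  have has : ContDiff ℝ (⊤ : ℕ∞) a := hhs.comp (contDiff_fst.div_const _)
  have hbs : ContDiff ℝ (⊤ : ℕ∞) b := hhs.comp (hf₂.div_const _)
  have hcs : ContDiff ℝ (⊤ : ℕ∞) c := hhs.comp (hf₃.div_const _)
  have hws : ContDiff ℝ (⊤ : ℕ∞) w := (has.mul hbs).mul hcs
  set Z : Set (ℝ × ℝ) := {x | δ ^ 2 ≤ x.1 ∧ δ ^ 2 ≤ R ^ 2 - (x.1 ^ 2 + x.2 ^ 2) ∧
    4 * R₁ ^ 2 * δ ^ 2 ≤ crackGauge R₁ x} with hZ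
  have hZc : IsClosed Z := (isClosed_le continuous_const continuous_fst).inter
    ((isClosed_le continuous_const hf₂.continuous).inter
      (isClosed_le continuous_const hf₃.continuous))
  have hwZ : tsupport w ⊆ Z := by
    refine closure_minimal (fun x hx => ?_) hZc
    have hx' : a x * b x * c x ≠ 0 := hx
    refine ⟨?_, ?_, ?_⟩ <;> by_contra! hlt <;> apply hx'
    · simp only [ha, hh0 _ ((div_lt_one hη).2 hlt), zero_mul]
    · simp only [hb, hh0 _ ((div_lt_one hη).2 hlt), mul_zero, zero_mul]
    · simp only [hc, hh0 _ ((div_lt_one hη₃).2 hlt), mul_zero]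
  have hZdisk : ∀ x ∈ Z, 0 < x.1 ∧ x.1 ^ 2 + x.2 ^ 2 < R ^ 2 := fun x hx =>
    ⟨hη.trans_le hx.1, by linarith [hx.2.1]⟩
  have hwc : HasCompactSupport w :=
    (isCompact_Icc.prod isCompact_Icc).of_isClosed_subset (isClosed_tsupport _)
      fun x hx => disk_subset_prod hR.le (hZdisk x (hwZ hx)).2
  set u : ℝ × ℝ → ℝ := fun x => φ x * w x with hu
  have hus : tsupport u ⊆ Z := (tsupport_mul_subset_right (f := φ) (g := w)).trans hwZ
  have huc : HasCompactSupport u := hwc.mul_left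
  have hut : testFun ((disk R \ crackSet R₁ δ) ∩ {x | 0 < x.1}) u := by
    refine ⟨hφs.mul hws, huc, fun x hx => ⟨⟨(hZdisk x (hus hx)).2, fun hxK => ?_⟩,
      (hZdisk x (hus hx)).1⟩⟩
    obtain ⟨e1, e2⟩ := crackSet_fst_sq_le hxK
    have h3 := (hus hx).2.2
    rw [crackGauge, e1] at h3
    nlinarith
  have hmass : m ≤ ∫ x, u x ^ 2 := by
    set D : Set (ℝ × ℝ) := Icc (R / 4) (R / 2) ×ˢ Icc 0 (R / 4) with hD
    have hle : ∀ x ∈ D, (R / 4 * g (R ^ 2 / 2)) ^ 2 ≤ u x ^ 2 := by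
      rintro x ⟨⟨h1, h2⟩, h3, h4⟩
      obtain ⟨p1, p2, p3, p4, p5⟩ := cutoffs_plateau hR₁ hR₁R hδ0 hδa hδR hδR2 ⟨⟨h1, h2⟩, h3, h4⟩
      have a1 : a x = 1 := hh1 _ ((le_div_iff₀ hη).2 p1)
      have b1 : b x = 1 := hh1 _ ((le_div_iff₀ hη).2 p2)
      have c1 : c x = 1 := hh1 _ ((le_div_iff₀ hη₃).2 p3)
      have hux : u x = x.1 * g (x.1 ^ 2 + x.2 ^ 2) := by
        simp only [hu, hw, a1, b1, c1, hφ, mul_one]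
      rw [hux]
      have hgx : g (R ^ 2 / 2) ≤ g (x.1 ^ 2 + x.2 ^ 2) :=
        hg.anti ⟨by positivity, p5⟩ ⟨by positivity, half_le_self (sq_nonneg R)⟩ p4
      have : 0 ≤ x.1 := by linarith
      gcongr
    have hDc : IsCompact D := isCompact_Icc.prod isCompact_Icc
    have h_integ : Integrable fun x => u x ^ 2 := integrable_sq hut.1.continuous huc
    have h1 := setIntegral_ge_of_const_le_real hDc.measurableSet hDc.measure_ne_top hle
      h_integ.integrableOn
    have h2 := setIntegral_le_integral (s := D) h_integ (.of_forall fun x => sq_nonneg _)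
    rw [hD, volume_real_prod_Icc (by linarith) (by linarith), ← hD] at h1
    refine le_trans (le_of_eq ?_) (h1.trans h2)
    rw [hm]
    ring
  have hu0 : u ≠ 0 := by
    intro h0
    rw [h0] at hmass
    simp only [Pi.zero_apply, ne_eq, OfNat.ofNat_ne_zero, not_false_eq_true, zero_pow,
      integral_zero] at hmass
    linarith
  obtain ⟨S, hS⟩ : ∃ S, S = Icc (δ ^ 2) (2 * δ ^ 2) ×ˢ Icc (-R) R ∪
      {x : ℝ × ℝ | R ^ 2 - (x.1 ^ 2 + x.2 ^ 2) ∈ Icc (δ ^ 2) (2 * δ ^ 2)} ∪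
      (Icc (-(3 * R₁ * δ)) (3 * R₁ * δ) ×ˢ
        Icc (R₁ - (3 + 9 * R₁) * δ) (R₁ + (3 + 9 * R₁) * δ) ∪
      Icc (-(3 * R₁ * δ)) (3 * R₁ * δ) ×ˢ
        Icc (-R₁ - (3 + 9 * R₁) * δ) (-R₁ + (3 + 9 * R₁) * δ)) := ⟨_, rfl⟩
  obtain ⟨hSfin, hSV⟩ := volume_cutoff_layers_le hR hR₁ hδ0 (by linarith) hS
  have hgrad : ∀ x, gradSq w x ≤ 3 * (gradSq a x + gradSq b x + gradSq c x) := fun x =>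
    gradSq_mul_mul_le (has.differentiable (by simp)) (hbs.differentiable (by simp))
      (hcs.differentiable (by simp)) x (hh01 _) (hh01 _) (hh01 _)
  have hdf₂ := hf₂.differentiable (by simp)
  have hdf₃ := hf₃.differentiable (by simp)
  have hF0 : ∀ x ∉ S, φ x ^ 2 * gradSq w x = 0 := by
    intro x hxS
    by_cases hxw : x ∈ tsupport w
    · have hxR := (disk_subset_prod hR.le (hZdisk x (hwZ hxw)).2).2
      have z1 : gradSq a x = 0 := gradSq_cutoff_eq_zero hhd differentiable_fst hη hhout
        fun hx => hxS (hS ▸ .inl (.inl ⟨hx, hxR⟩))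
      have z2 : gradSq b x = 0 := gradSq_cutoff_eq_zero hhd hdf₂ hη hhout
        fun hx => hxS (hS ▸ .inl (.inr hx))
      have z3 : gradSq c x = 0 := gradSq_cutoff_eq_zero hhd hdf₃ hη₃ hhout
        fun hx => hxS (hS ▸ .inr (crackGauge_mem hR₁ hδ0 (by linarith) (by linarith [hx.2])))
      have := hgrad x
      rw [z1, z2, z3] at this
      have hz : gradSq w x = 0 := le_antisymm (by linarith) (gradSq_nonneg _ _)
      rw [hz, mul_zero]
    · rw [gradSq_eq_zero_of_notMem_tsupport hxw, mul_zero]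
  have hFK : ∀ x, φ x ^ 2 * gradSq w x ≤ K := by
    intro x
    by_cases hxw : x ∈ tsupport w
    · obtain ⟨hx0, hxR⟩ := hZdisk x (hwZ hxw)
      have hs : x.1 ^ 2 + x.2 ^ 2 ∈ Icc 0 (R ^ 2) := ⟨by positivity, hxR.le⟩
      have hg0 : 0 ≤ g (x.1 ^ 2 + x.2 ^ 2) := hg.nonneg hs
      have hgle : g (x.1 ^ 2 + x.2 ^ 2) ≤ g 0 := hg.anti ⟨le_rfl, sq_nonneg _⟩ hs hs.1
      have hφ1 : φ x ^ 2 ≤ g 0 ^ 2 * x.1 ^ 2 := by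
        rw [← mul_pow, mul_comm (g 0)]
        exact pow_le_pow_left₀ (mul_nonneg hx0.le hg0) (mul_le_mul_of_nonneg_left hgle hx0.le) 2
      have k1 : φ x ^ 2 * gradSq a x ≤ H * (4 * g 0 ^ 2) := by
        refine mul_gradSq_cutoff_le hhd differentiable_fst hη hhout hH (sq_nonneg _)
          (by positivity) x fun hx => ?_
        rw [gradSq_fst, mul_one]
        have : x.1 ^ 2 ≤ (2 * δ ^ 2) ^ 2 := pow_le_pow_left₀ hx0.le hx.2 2
        calc φ x ^ 2 ≤ g 0 ^ 2 * x.1 ^ 2 := hφ1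
          _ ≤ g 0 ^ 2 * (2 * δ ^ 2) ^ 2 := by gcongr
          _ = _ := by ring
      have k2 : φ x ^ 2 * gradSq b x ≤ H * (16 * R ^ 4 * L ^ 2) := by
        refine mul_gradSq_cutoff_le hhd hdf₂ hη hhout hH (sq_nonneg _)
          (by positivity) x fun hx => ?_
        rw [gradSq_const_sub_normSq]
        have h1 : x.1 ≤ R := (disk_subset_prod hR.le hxR).1.2
        have h2 : g (x.1 ^ 2 + x.2 ^ 2) ≤ L * (2 * δ ^ 2) :=
          (hL _ hs).trans (mul_le_mul_of_nonneg_left hx.2 hL0)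
        have h3 : φ x ≤ R * (L * (2 * δ ^ 2)) := mul_le_mul h1 h2 hg0 hR.le
        have h4 : 0 ≤ φ x := mul_nonneg hx0.le hg0
        calc φ x ^ 2 * (4 * (x.1 ^ 2 + x.2 ^ 2))
            ≤ (R * (L * (2 * δ ^ 2))) ^ 2 * (4 * R ^ 2) := by gcongr
          _ = _ := by ring
      have k3 : φ x ^ 2 * gradSq c x ≤ H * (4 * g 0 ^ 2 * (8 + 32 * R ^ 2)) := by
        refine mul_gradSq_cutoff_le hhd hdf₃ hη₃ hhout hH (sq_nonneg _)
          (by positivity) x fun hx => ?_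
        have h1 : x.1 ^ 2 ≤ crackGauge R₁ x := le_add_of_nonneg_right (sq_nonneg _)
        have h2 : 0 ≤ crackGauge R₁ x := (sq_nonneg _).trans h1
        have h3 : gradSq (crackGauge R₁) x ≤ (8 + 32 * R ^ 2) * crackGauge R₁ x := by
          refine (gradSq_sq_add_sq_le (R₁ ^ 2) x).trans (mul_le_mul_of_nonneg_right ?_ h2)
          linarith
        calc φ x ^ 2 * gradSq (crackGauge R₁) x
            ≤ (g 0 ^ 2 * crackGauge R₁ x) * ((8 + 32 * R ^ 2) * crackGauge R₁ x) :=
              mul_le_mul (hφ1.trans (mul_le_mul_of_nonneg_left h1 (sq_nonneg _))) h3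
                (gradSq_nonneg _ _) (mul_nonneg (sq_nonneg _) h2)
          _ = g 0 ^ 2 * (8 + 32 * R ^ 2) * crackGauge R₁ x ^ 2 := by ring
          _ ≤ g 0 ^ 2 * (8 + 32 * R ^ 2) * (2 * (4 * R₁ ^ 2 * δ ^ 2)) ^ 2 := by
            gcongr
            exact hx.2
          _ = _ := by ring
      have k0 := mul_le_mul_of_nonneg_left (hgrad x) (sq_nonneg (φ x))
      rw [hK]
      linarith
    · rw [gradSq_eq_zero_of_notMem_tsupport hxw, mul_zero]
      exact hK0
  have hE : ∫ x, φ x ^ 2 * gradSq w x ≤ K * (V * δ ^ 2) :=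
    (integral_le_of_le_const hSfin hF0
      (fun x => mul_nonneg (sq_nonneg _) (gradSq_nonneg _ _)) hFK).trans
        (mul_le_mul_of_nonneg_left hSV hK0)
  refine (dirichletEV_two_le (reflectFst_preimage_disk_sdiff_crackSet R₁ R δ) hut hu0).trans ?_
  have hpos : 0 < ∫ x, u x ^ 2 := hm0.trans_le hmass
  rw [div_le_iff₀ hpos]
  have hid := integral_gradSq_mul (l := 4 * κ) hφs
    (laplacian_fst_mul hg.contDiff hg.ode) hws hwc
  have hid' : ∫ x, gradSq u x = 4 * κ * (∫ x, u x ^ 2) + ∫ x, φ x ^ 2 * gradSq w x := hid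
  have hlast : K * (V * δ ^ 2) ≤ K * V / m * δ ^ 2 * ∫ x, u x ^ 2 := by
    calc K * (V * δ ^ 2) = K * V / m * δ ^ 2 * m := by field_simp
      _ ≤ _ := mul_le_mul_of_nonneg_left hmass (by positivity)
  rw [hid']
  linarith

/-- for `δ` small enough, `λ₂(B_{R₂} \ K_δ) < λ₁(B_{R₂}⁺ \ K_δ⁺)`
(i.e. `λ₁^{NDD} < λ₁^{DND}` for `ε` close to `π/2`). -/
theorem NDD_lt_DND_near_closing (R₁ R₂ : ℝ) (hR₁ : 0 < R₁) (hR₁₂ : R₁ < R₂) :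
    ∃ δ₀ ∈ Set.Ioo (0 : ℝ) (π / 2), ∀ δ ∈ Set.Ioo (0 : ℝ) δ₀,
      dirichletEV (disk R₂ \ crackSet R₁ δ) 2 <
        dirichletEV (halfDisk R₂ \ crackSetPlus R₁ δ) 1 := by
  obtain ⟨κ, g, hg⟩ := exists_isRadialFactor (hR₁.trans hR₁₂)
  obtain ⟨c, hc, hlow⟩ := hg.exists_le_dirichletEV_one hR₁ hR₁₂
  obtain ⟨C, δ₁, hδ₁, hC, hup⟩ := hg.exists_dirichletEV_two_le hR₁ hR₁₂
  have hpi := pi_pos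
  refine ⟨min (π / 4) (min δ₁ (c / (C + 1))), ⟨by positivity,
    (min_le_left _ _).trans_lt (by linarith)⟩, ?_⟩
  rintro δ ⟨hδ0, hδ⟩
  obtain ⟨h1, h2⟩ := lt_min_iff.1 hδ
  obtain ⟨h3, h4⟩ := lt_min_iff.1 h2
  rw [lt_div_iff₀ (by positivity)] at h4
  calc dirichletEV (disk R₂ \ crackSet R₁ δ) 2 ≤ 4 * κ + C * δ ^ 2 := hup δ ⟨hδ0, h3⟩
    _ < 4 * κ + c * δ := by nlinarith
    _ ≤ _ := hlow δ ⟨hδ0, h1⟩
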